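/- arXiv:0904.3986 — 2 statements merged into one kernel-verified Lean document; each statement's English description precedes it below -/
import Mathlib

section
/- Let T ≥ 1, x₁ ∈ ℝ, and for each k ∈ {1,…,T} let h_k : ℝ → ℝ be convex and coercive (h_k(x) → ∞ as |x| → ∞), let c_k ≥ 0, and let L_k ≤ U_k and w̲_k ≤ w̄_k be reals. Define J_{T+1}(x) := 0 and, backwards for k = T,…,1, J_k(x) := min_{u ∈ [L_k,U_k]} [ c_k·u + max_{w ∈ [w̲_k,w̄_k]} ( h_k(x+u+w) + J_{k+1}(x+u+w) ) ]. Then there exist affine functions q_k(w₁,…,w_{k−1}) = q_{k,0} + Σ_{t=1}^{k−1} q_{k,t}·w_t and z_k(w₁,…,w_k) = z_{k,0} + Σ_{t=1}^{k} z_{k,t}·w_t, for k = 1,…,T, such that for every k ∈ {1,…,T}: (i) L_k ≤ q_k(w₁,…,w_{k−1}) ≤ U_k for all (w₁,…,w_{k−1}) ∈ ∏_{t<k}[w̲_t,w̄_t]; (ii) z_k(w₁,…,w_k) ≥ h_k( x₁ + Σ_{t=1}^{k} ( q_t(w₁,…,w_{t−1}) + w_t ) ) for all (w₁,…,w_k)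 ∈ ∏_{t≤k}[w̲_t,w̄_t]; and (iii) J_1(x₁) = max over (w₁,…,w_k) ∈ ∏_{t≤k}[w̲_t,w̄_t] of [ Σ_{t=1}^{k} ( c_t·q_t(w₁,…,w_{t−1}) + z_t(w₁,…,w_t) ) + J_{k+1}( x₁ + Σ_{t=1}^{k} ( q_t(w₁,…,w_{t−1}) + w_t ) ) ]. -/
/-- A finite convex function on the real line has a supporting line at every point. -/
theorem ConvexOn.exists_subgradient {g : ℝ → ℝ} (hg : ConvexOn ℝ Set.univ g) (y : ℝ) :
    ∃ t : ℝ, ∀ x, g y + t * (x - y) ≤ g x := by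
  have hy : y ∈ interior (Set.univ : Set ℝ) := by simp
  refine ⟨derivWithin g (Set.Ioi y) y, fun x => ?_⟩
  rcases lt_trichotomy x y with hxy | rfl | hxy
  · have h1 := hg.slope_le_leftDeriv_of_mem_interior (Set.mem_univ x) hy hxy
    have h2 := h1.trans (hg.leftDeriv_le_rightDeriv_of_mem_interior hy)
    rw [slope_def_field, div_le_iff₀ (sub_pos.2 hxy)] at h2
    linarith
  · simp
  · have h1 := hg.rightDeriv_le_slope_of_mem_interior hy (Set.mem_univ x) hxy
    rw [slope_def_field, le_div_iff₀ (sub_pos.2 hxy)] at h1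
    linarith

/-- Convex functions have increasing differences. -/
theorem ConvexOn.map_add_add_map_add_le {f : ℝ → ℝ} (hf : ConvexOn ℝ Set.univ f) (x : ℝ)
    {d e : ℝ} (hde : 0 ≤ d * e) : f (x + d) + f (x + e) ≤ f x + f (x + d + e) := by
  rcases eq_or_ne (d + e) 0 with h0 | h0
  · have hd : d = 0 := by nlinarith [sq_nonneg d]
    subst hd
    simp
  · have hpos : 0 < (d + e) ^ 2 := by positivity
    have hα : 0 ≤ d / (d + e) := by
      have : d / (d + e) = (d ^ 2 + d * e) / (d + e) ^ 2 := by field_simp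
      rw [this]; positivity
    have hβ : 0 ≤ e / (d + e) := by
      have : e / (d + e) = (e ^ 2 + d * e) / (d + e) ^ 2 := by field_simp; ring
      rw [this]; positivity
    have h1 : d / (d + e) + e / (d + e) = 1 := by field_simp
    have h2 : e / (d + e) + d / (d + e) = 1 := by rw [add_comm]; exact h1
    have i1 := hf.2 (Set.mem_univ x) (Set.mem_univ (x + d + e)) hβ hα h2
    have i2 := hf.2 (Set.mem_univ x) (Set.mem_univ (x + d + e)) hα hβ h1
    simp only [smul_eq_mul] at i1 i2
    have e1 : e / (d + e) * x + d / (d + e) * (x + d + e) = x + d := by field_simp; ring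
    have e2 : d / (d + e) * x + e / (d + e) * (x + d + e) = x + e := by field_simp; ring
    rw [e1] at i1
    rw [e2] at i2
    have h3 : d / (d + e) = 1 - e / (d + e) := by linarith
    rw [h3] at i1 i2
    linarith

/-- Translating the argument of a convex function and adding a constant preserve convexity. -/
theorem ConvexOn.comp_add_right_add_const {f : ℝ → ℝ} (hf : ConvexOn ℝ Set.univ f) (d κ : ℝ) :
    ConvexOn ℝ Set.univ (fun y => f (y + d) + κ) :=
  (hf.translate_left d).add_const κ

/-- Lowering the coefficients `b` by a total weighted amount of at most `D` so that the weighted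
positive parts of `t * b - a` shrink as much as possible for every slope `t`. -/
theorem exists_truncation {ι : Type*} (s : Finset ι) (R a b : ι → ℝ)
    (ha : ∀ i ∈ s, 0 ≤ a i) (hb : ∀ i ∈ s, 0 ≤ b i) (hR : ∀ i ∈ s, 0 ≤ R i)
    {D : ℝ} (hD : 0 ≤ D) :
    ∃ p : ι → ℝ, (∀ i ∈ s, 0 ≤ p i ∧ p i ≤ b i) ∧ ∑ i ∈ s, R i * (b i - p i) ≤ D ∧
      ∀ t, 0 < t → ∑ i ∈ s, R i * max (t * p i - a i) 0 ≤
        max 0 (∑ i ∈ s, R i * max (t * b i - a i) 0 - t * D) := by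
  set Φ : ℝ → ℝ := fun σ => ∑ i ∈ s, R i * max (b i - σ * a i) 0 with hΦ
  have hcont : Continuous Φ := by fun_prop
  by_cases h0 : Φ 0 ≤ D
  · refine ⟨fun _ => 0, fun i hi => ⟨le_rfl, hb i hi⟩, ?_, fun t ht => ?_⟩
    · refine le_trans (Finset.sum_le_sum fun i hi => ?_) h0
      exact mul_le_mul_of_nonneg_left (by simp) (hR i hi)
    · refine le_max_of_le_left (Finset.sum_nonpos fun i hi => ?_)
      have : max (t * 0 - a i) 0 = 0 := max_eq_right (by simpa using ha i hi)
      rw [this, mul_zero]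
  push Not at h0
  by_cases h1 : ∃ σ, 0 ≤ σ ∧ Φ σ ≤ D
  · obtain ⟨σ₁, hσ₁, hΦ₁⟩ := h1
    obtain ⟨σ, ⟨hσ, -⟩, hσD⟩ :=
      intermediate_value_Icc' hσ₁ hcont.continuousOn ⟨hΦ₁, h0.le⟩
    refine ⟨fun i => min (b i) (σ * a i),
      fun i hi => ⟨le_min (hb i hi) (mul_nonneg hσ (ha i hi)), min_le_left _ _⟩, ?_,
      fun t ht => ?_⟩
    · rw [← hσD]
      refine Finset.sum_le_sum fun i hi => mul_le_mul_of_nonneg_left ?_ (hR i hi)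
      rcases le_total (b i) (σ * a i) with h | h
      · simp [h]
      · simp [h]
    · rcases le_total (t * σ) 1 with hts | hts
      · refine le_max_of_le_left (Finset.sum_nonpos fun i hi => ?_)
        have h2 : t * min (b i) (σ * a i) ≤ a i := by
          have := mul_le_mul_of_nonneg_left (min_le_right (b i) (σ * a i)) ht.le
          nlinarith [ha i hi]
        rw [max_eq_right (by linarith)]
        simp
      · refine le_max_of_le_right (le_of_eq ?_)
        rw [← hσD, hΦ, Finset.mul_sum, ← Finset.sum_sub_distrib]
        refine Finset.sum_congr rfl fun i hi => ?_
        have h3 : a i ≤ t * (σ * a i) := by nlinarith [ha i hi]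
        dsimp only
        rcases le_total (b i) (σ * a i) with h | h
        · simp [h]
        · have h4 := mul_le_mul_of_nonneg_left h ht.le
          rw [min_eq_right h, max_eq_left (by linarith), max_eq_left (by linarith),
            max_eq_left (by linarith)]
          ring
  · push Not at h1
    set B : ℝ := ∑ i ∈ s, if a i = 0 then R i * b i else 0 with hB
    have hBD : D < B := by
      set σ : ℝ := ∑ i ∈ s, b i / a i with hσ
      have hterm : ∀ i ∈ s, 0 ≤ b i / a i := fun i hi => div_nonneg (hb i hi) (ha i hi)
      refine (h1 σ (Finset.sum_nonneg hterm)).trans_le (Finset.sum_le_sum fun i hi => ?_)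
      split_ifs with h
      · simp [h, hb i hi]
      · have h5 : b i / a i ≤ σ := Finset.single_le_sum hterm hi
        rw [div_le_iff₀ (lt_of_le_of_ne (ha i hi) (Ne.symm h))] at h5
        rw [max_eq_right (by linarith)]
        simp
    have hBpos : 0 < B := hD.trans_lt hBD
    have hlam : 0 ≤ 1 - D / B := by
      rw [sub_nonneg, div_le_one hBpos]; exact hBD.le
    have hsum : ∑ i ∈ s, (if a i = 0 then D / B * (R i * b i) else 0) = D := by
      have : ∀ i ∈ s, (if a i = 0 then D / B * (R i * b i) else 0)
          = D / B * (if a i = 0 then R i * b i else 0) := fun i _ => by split_ifs <;> simp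
      rw [Finset.sum_congr rfl this, ← Finset.mul_sum, ← hB]
      field_simp
    have hlam' : 0 ≤ D / B := by positivity
    refine ⟨fun i => if a i = 0 then (1 - D / B) * b i else b i, fun i hi => ?_, ?_,
      fun t ht => ?_⟩
    · have := hb i hi
      dsimp only
      split_ifs
      · exact ⟨by positivity, by nlinarith⟩
      · exact ⟨this, le_rfl⟩
    · refine le_of_eq (Eq.trans (Finset.sum_congr rfl fun i _ => ?_) hsum)
      dsimp only
      split_ifs <;> ring
    · refine le_max_of_le_right (le_of_eq ?_)
      nth_rewrite 2 [← hsum]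
      rw [Finset.mul_sum, ← Finset.sum_sub_distrib]
      refine Finset.sum_congr rfl fun i hi => ?_
      have := hb i hi
      dsimp only
      split_ifs with h
      · rw [h, max_eq_left (by simp only [sub_zero]; positivity),
          max_eq_left (by simp only [sub_zero]; positivity)]
        ring
      · simp

/-- One-sided form of `exists_truncation`, phrased through linear forms on the box `∏ [0, R i]`. -/
theorem exists_truncation_box {ι : Type*} (s : Finset ι) (R a b : ι → ℝ)
    (ha : ∀ i ∈ s, 0 ≤ a i) (hR : ∀ i ∈ s, 0 ≤ R i) {D : ℝ} (hD : 0 ≤ D) :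
    ∃ p : ι → ℝ, (∀ i ∈ s, 0 ≤ p i ∧ p i ≤ max (b i) 0) ∧
      ∑ i ∈ s, R i * (max (b i) 0 - p i) ≤ D ∧
      ∀ t, 0 < t → ∀ e v : ι → ℝ, (∀ i ∈ s, e i ≤ p i) → (∀ i ∈ s, v i ∈ Set.Icc 0 (R i)) →
        ∑ i ∈ s, (t * e i - a i) * v i ≤ 0 ∨
        ∃ v' : ι → ℝ, (∀ i ∈ s, v' i ∈ Set.Icc 0 (R i)) ∧
          ∑ i ∈ s, (t * e i - a i) * v i ≤ ∑ i ∈ s, (t * b i - a i) * v' i - t * D := by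
  obtain ⟨p, hp, hpD, hpt⟩ := exists_truncation s R a (fun i => max (b i) 0) ha
    (fun i _ => le_max_right _ _) hR hD
  refine ⟨p, hp, hpD, fun t ht e v he hv => ?_⟩
  have key : ∑ i ∈ s, (t * e i - a i) * v i ≤ ∑ i ∈ s, R i * max (t * p i - a i) 0 := by
    refine Finset.sum_le_sum fun i hi => ?_
    obtain ⟨hv0, hv1⟩ := hv i hi
    have h1 : t * e i - a i ≤ max (t * p i - a i) 0 :=
      le_max_of_le_left (by linarith [mul_le_mul_of_nonneg_left (he i hi) ht.le])
    have h2 : 0 ≤ max (t * p i - a i) 0 := le_max_right _ _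
    nlinarith [mul_le_mul_of_nonneg_right h1 hv0, mul_le_mul_of_nonneg_left hv1 h2]
  rcases le_max_iff.1 (key.trans (hpt t ht)) with h | h
  · exact Or.inl h
  · refine Or.inr ⟨fun i => if 0 ≤ t * b i - a i then R i else 0, fun i hi => ?_,
      h.trans (le_of_eq ?_)⟩
    · have := hR i hi
      dsimp only
      split_ifs <;> simp [this]
    · congr 1
      refine Finset.sum_congr rfl fun i hi => ?_
      have hai := ha i hi
      dsimp only
      rcases le_total 0 (b i) with hbi | hbi
      · rw [max_eq_left hbi]
        split_ifs with h3
        · rw [max_eq_left h3, mul_comm]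
        · rw [max_eq_right (not_le.1 h3).le]; simp
      · have h4 : t * b i ≤ 0 := mul_nonpos_of_nonneg_of_nonpos ht.le hbi
        rw [max_eq_right hbi, max_eq_right (by linarith)]
        split_ifs with h3
        · have : t * b i - a i = 0 := by linarith
          simp [this]
        · simp

/-- Affine selection of a control on a box on which the accumulated cost `M - ∑ a i * v i` is
maximal at the origin. -/
theorem exists_affine_control_of_nonneg {ι : Type*} (s : Finset ι) (R a b : ι → ℝ)
    (ha : ∀ i ∈ s, 0 ≤ a i) (hR : ∀ i ∈ s, 0 ≤ R i) {g : ℝ → ℝ} (hg : ConvexOn ℝ Set.univ g)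
    {L U M Y V : ℝ}
    (H : ∀ v : ι → ℝ, (∀ i ∈ s, v i ∈ Set.Icc 0 (R i)) → ∃ u ∈ Set.Icc L U,
      M - ∑ i ∈ s, a i * v i + g (Y + ∑ i ∈ s, b i * v i + u) ≤ V) :
    ∃ (q₀ : ℝ) (q : ι → ℝ), ∀ v : ι → ℝ, (∀ i ∈ s, v i ∈ Set.Icc 0 (R i)) →
      q₀ + ∑ i ∈ s, q i * v i ∈ Set.Icc L U ∧
      M - ∑ i ∈ s, a i * v i + g (Y + ∑ i ∈ s, b i * v i + (q₀ + ∑ i ∈ s, q i * v i)) ≤ V := by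
  obtain ⟨u, ⟨hLu, huU⟩, hu⟩ := H (fun _ => 0) fun i hi => ⟨le_rfl, hR i hi⟩
  simp only [mul_zero, Finset.sum_const_zero, sub_zero, add_zero] at hu
  obtain ⟨p, hp, hpD, hpt⟩ := exists_truncation_box s R a b ha hR (sub_nonneg.2 hLu)
  obtain ⟨n, hn, hnD, hnt⟩ :=
    exists_truncation_box s R a (fun i => -b i) ha hR (sub_nonneg.2 huU)
  have hb : ∀ i, b i = max (b i) 0 - max (-b i) 0 := fun i => by
    rcases le_total 0 (b i) with h | h
    · rw [max_eq_left h, max_eq_right (by linarith)]; ring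
    · rw [max_eq_right h, max_eq_left (by linarith)]; ring
  refine ⟨u, fun i => p i - n i - b i, fun v hv => ⟨⟨?_, ?_⟩, ?_⟩⟩
  · have : -∑ i ∈ s, R i * (max (b i) 0 - p i) ≤ ∑ i ∈ s, (p i - n i - b i) * v i := by
      rw [← Finset.sum_neg_distrib]
      refine Finset.sum_le_sum fun i hi => ?_
      obtain ⟨hv0, hv1⟩ := hv i hi
      have h1 := mul_le_mul_of_nonneg_right hv1 (sub_nonneg.2 (hp i hi).2)
      have h2 := mul_nonneg hv0 (sub_nonneg.2 (hn i hi).2)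
      have h3 : (p i - n i - b i) * v i =
        -(v i * (max (b i) 0 - p i)) + v i * (max (-b i) 0 - n i) := by
        linear_combination (-v i) * hb i
      rw [h3]
      linarith
    linarith
  · have : ∑ i ∈ s, (p i - n i - b i) * v i ≤ ∑ i ∈ s, R i * (max (-b i) 0 - n i) := by
      refine Finset.sum_le_sum fun i hi => ?_
      obtain ⟨hv0, hv1⟩ := hv i hi
      have h1 := mul_le_mul_of_nonneg_right hv1 (sub_nonneg.2 (hn i hi).2)
      have h2 := mul_nonneg hv0 (sub_nonneg.2 (hp i hi).2)
      have h3 : (p i - n i - b i) * v i =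
        -(v i * (max (b i) 0 - p i)) + v i * (max (-b i) 0 - n i) := by
        linear_combination (-v i) * hb i
      rw [h3]
      linarith
    linarith
  · have hy : Y + ∑ i ∈ s, b i * v i + (u + ∑ i ∈ s, (p i - n i - b i) * v i)
        = Y + u + ∑ i ∈ s, (p i - n i) * v i := by
      have : ∑ i ∈ s, (p i - n i) * v i
          = ∑ i ∈ s, b i * v i + ∑ i ∈ s, (p i - n i - b i) * v i := by
        rw [← Finset.sum_add_distrib]
        exact Finset.sum_congr rfl fun i _ => by ring
      rw [this]; ring
    rw [hy]
    set S := ∑ i ∈ s, (p i - n i) * v i with hS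
    obtain ⟨t, ht⟩ := hg.exists_subgradient (Y + u + S)
    have hsplit : ∀ (τ : ℝ) (e v' : ι → ℝ), ∑ i ∈ s, (τ * e i - a i) * v' i
        = τ * ∑ i ∈ s, e i * v' i - ∑ i ∈ s, a i * v' i := fun τ e v' => by
      rw [Finset.mul_sum, ← Finset.sum_sub_distrib]
      exact Finset.sum_congr rfl fun i _ => by ring
    have hav : 0 ≤ ∑ i ∈ s, a i * v i :=
      Finset.sum_nonneg fun i hi => mul_nonneg (ha i hi) (hv i hi).1
    have htop := ht (Y + u)
    rcases lt_trichotomy t 0 with htneg | rfl | htpos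
    · have hSn : ∑ i ∈ s, (n i - p i) * v i = -S := by
        rw [hS, ← Finset.sum_neg_distrib]
        exact Finset.sum_congr rfl fun i _ => by ring
      rcases hnt (-t) (neg_pos.2 htneg) (fun i => n i - p i) v
        (fun i hi => by linarith [(hp i hi).1]) hv with h | ⟨v', hv', h⟩
      · rw [hsplit, hSn] at h
        linarith
      · rw [hsplit, hsplit, hSn] at h
        obtain ⟨u', ⟨_, hu'⟩, h'⟩ := H v' hv'
        have hsub := ht (Y + ∑ i ∈ s, b i * v' i + u')
        have hbn : ∑ i ∈ s, -b i * v' i = -∑ i ∈ s, b i * v' i := by simp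
        rw [hbn] at h
        have := mul_nonneg (neg_pos.2 htneg).le (sub_nonneg.2 hu')
        linarith
    · linarith
    · rcases hpt t htpos (fun i => p i - n i) v
        (fun i hi => by linarith [(hn i hi).1]) hv with h | ⟨v', hv', h⟩
      · rw [hsplit, ← hS] at h
        linarith
      · rw [hsplit, hsplit, ← hS] at h
        obtain ⟨u', ⟨hu', _⟩, h'⟩ := H v' hv'
        have hsub := ht (Y + ∑ i ∈ s, b i * v' i + u')
        have := mul_nonneg htpos.le (sub_nonneg.2 hu')
        linarith

/-- If every point of a box admits a control in `[L, U]` keeping the total cost below `V`, then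
such a control can be chosen as an affine function of the point. -/
theorem exists_affine_control {ι : Type*} (s : Finset ι) (lo hi a b : ι → ℝ)
    (hle : ∀ i ∈ s, lo i ≤ hi i) {g : ℝ → ℝ} (hg : ConvexOn ℝ Set.univ g) {L U a₀ b₀ V : ℝ}
    (H : ∀ w : ι → ℝ, (∀ i ∈ s, w i ∈ Set.Icc (lo i) (hi i)) → ∃ u ∈ Set.Icc L U,
      a₀ + ∑ i ∈ s, a i * w i + g (b₀ + ∑ i ∈ s, b i * w i + u) ≤ V) :
    ∃ (q₀ : ℝ) (q : ι → ℝ), ∀ w : ι → ℝ, (∀ i ∈ s, w i ∈ Set.Icc (lo i) (hi i)) →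
      q₀ + ∑ i ∈ s, q i * w i ∈ Set.Icc L U ∧
      a₀ + ∑ i ∈ s, a i * w i + g (b₀ + ∑ i ∈ s, b i * w i + (q₀ + ∑ i ∈ s, q i * w i)) ≤ V := by
  set ε : ι → ℝ := fun i => if 0 ≤ a i then 1 else -1 with hε
  set top : ι → ℝ := fun i => if 0 ≤ a i then hi i else lo i with htop
  have hεε : ∀ i, ε i * ε i = 1 := fun i => by simp only [hε]; split_ifs <;> norm_num
  have hεa : ∀ i, 0 ≤ a i * ε i := fun i => by
    simp only [hε]; split_ifs with h
    · simpa using h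
    · linarith
  have hmem : ∀ i ∈ s, ∀ r, r ∈ Set.Icc 0 (hi i - lo i) →
      top i - ε i * r ∈ Set.Icc (lo i) (hi i) := fun i hi' r hr => by
    obtain ⟨h0, h1⟩ := hr
    simp only [hε, htop]
    split_ifs <;> constructor <;> linarith
  have hmem' : ∀ i ∈ s, ∀ r, r ∈ Set.Icc (lo i) (hi i) →
      ε i * (top i - r) ∈ Set.Icc 0 (hi i - lo i) := fun i hi' r hr => by
    obtain ⟨h0, h1⟩ := hr
    simp only [hε, htop]
    split_ifs <;> constructor <;> linarith
  have hcoord : ∀ (α v : ι → ℝ), ∑ i ∈ s, α i * (top i - ε i * v i)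
      = ∑ i ∈ s, α i * top i - ∑ i ∈ s, α i * ε i * v i := fun α v => by
    rw [← Finset.sum_sub_distrib]
    exact Finset.sum_congr rfl fun i _ => by ring
  have hneg : ∀ v : ι → ℝ, ∑ i ∈ s, -(b i * ε i) * v i = -∑ i ∈ s, b i * ε i * v i := fun v => by
    rw [← Finset.sum_neg_distrib]
    exact Finset.sum_congr rfl fun i _ => by ring
  obtain ⟨q₀, q, hq⟩ := exists_affine_control_of_nonneg s (fun i => hi i - lo i)
    (fun i => a i * ε i) (fun i => -(b i * ε i)) (fun i _ => hεa i)
    (fun i h => sub_nonneg.2 (hle i h)) hg (L := L) (U := U)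
    (M := a₀ + ∑ i ∈ s, a i * top i) (Y := b₀ + ∑ i ∈ s, b i * top i) (V := V)
    (fun v hv => by
      obtain ⟨u, hu, h⟩ := H (fun i => top i - ε i * v i) fun i hi' => hmem i hi' _ (hv i hi')
      refine ⟨u, hu, ?_⟩
      rw [hcoord, hcoord] at h
      rw [hneg]
      convert h using 2
      · ring
      · congr 1; ring)
  refine ⟨q₀ + ∑ i ∈ s, q i * ε i * top i, fun i => -(q i * ε i), fun w hw => ?_⟩
  have key := hq (fun i => ε i * (top i - w i)) fun i hi' => hmem' i hi' _ (hw i hi')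
  have e1 : ∀ α : ι → ℝ, ∑ i ∈ s, α i * ε i * (ε i * (top i - w i))
      = ∑ i ∈ s, α i * top i - ∑ i ∈ s, α i * w i := fun α => by
    rw [← Finset.sum_sub_distrib]
    exact Finset.sum_congr rfl fun i _ => by linear_combination (α i * (top i - w i)) * hεε i
  have e2 : q₀ + ∑ i ∈ s, q i * ε i * top i + ∑ i ∈ s, -(q i * ε i) * w i
      = q₀ + ∑ i ∈ s, q i * (ε i * (top i - w i)) := by
    rw [add_assoc, ← Finset.sum_add_distrib]
    congr 1
    exact Finset.sum_congr rfl fun i _ => by ring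
  rw [hneg, e1, e1] at key
  rw [e2]
  refine ⟨key.1, ?_⟩
  convert key.2 using 2
  · ring
  · congr 1; ring

/-- If the sum of two convex costs of a state that is affine on a box, plus an affine function, is
at most `V`, then one of the two costs may be replaced by an affine upper bound. -/
theorem exists_affine_cost {ι : Type*} (s : Finset ι) (lo hi a b : ι → ℝ)
    (hle : ∀ i ∈ s, lo i ≤ hi i) {h J : ℝ → ℝ} (hh : ConvexOn ℝ Set.univ h)
    (hJ : ConvexOn ℝ Set.univ J) {a₀ b₀ V : ℝ}
    (H : ∀ w : ι → ℝ, (∀ i ∈ s, w i ∈ Set.Icc (lo i) (hi i)) →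
      a₀ + ∑ i ∈ s, a i * w i + h (b₀ + ∑ i ∈ s, b i * w i)
        + J (b₀ + ∑ i ∈ s, b i * w i) ≤ V) :
    ∃ (z₀ : ℝ) (z : ι → ℝ), ∀ w : ι → ℝ, (∀ i ∈ s, w i ∈ Set.Icc (lo i) (hi i)) →
      h (b₀ + ∑ i ∈ s, b i * w i) ≤ z₀ + ∑ i ∈ s, z i * w i ∧
      a₀ + ∑ i ∈ s, a i * w i + (z₀ + ∑ i ∈ s, z i * w i)
        + J (b₀ + ∑ i ∈ s, b i * w i) ≤ V := by
  classical
  induction s using Finset.induction_on generalizing h J with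
  | empty =>
    refine ⟨h b₀, fun _ => 0, fun w hw => ?_⟩
    have := H w hw
    simp only [Finset.sum_empty, add_zero] at this ⊢
    exact ⟨le_rfl, this⟩
  | insert j s hj ih =>
    set box : Set (ι → ℝ) := {w | ∀ i ∈ s, w i ∈ Set.Icc (lo i) (hi i)} with hbox
    set A : (ι → ℝ) → ℝ := fun w => a₀ + ∑ i ∈ s, a i * w i with hA
    set Y : (ι → ℝ) → ℝ := fun w => b₀ + ∑ i ∈ s, b i * w i with hY
    have hjle := hle j (Finset.mem_insert_self j s)
    have hends : ∀ w ∈ box, ∀ r ∈ Set.Icc (lo j) (hi j),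
        A w + a j * r + h (Y w + b j * r) + J (Y w + b j * r) ≤ V := by
      intro w hw r hr
      have h1 : ∀ α : ι → ℝ, ∑ i ∈ insert j s, α i * (Function.update w j r) i
          = α j * r + ∑ i ∈ s, α i * w i := fun α => by
        rw [Finset.sum_insert hj, Function.update_self]
        congr 1
        refine Finset.sum_congr rfl fun i hi' => ?_
        rw [Function.update_of_ne (ne_of_mem_of_not_mem hi' hj)]
      have h2 := H (Function.update w j r) fun i hi' => by
        rcases eq_or_ne i j with rfl | hne
        · simpa using hr
        · rw [Function.update_of_ne hne]
          exact hw i (Finset.mem_of_mem_insert_of_ne hi' hne)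
      rw [h1, h1] at h2
      have e1 : b₀ + (b j * r + ∑ i ∈ s, b i * w i) = Y w + b j * r := by simp only [hY]; ring
      rw [e1] at h2
      simp only [hA]
      linarith
    have hlo : lo j ∈ Set.Icc (lo j) (hi j) := ⟨le_rfl, hjle⟩
    have hhi : hi j ∈ Set.Icc (lo j) (hi j) := ⟨hjle, le_rfl⟩
    -- the pairwise compatibility that allows the coefficient of `w j` to be chosen first
    have hpair : ∀ w ∈ box, ∀ w' ∈ box,
        h (Y w + b j * hi j) + J (Y w + b j * lo j) + A w + a j * lo j - V ≤
          V - (h (Y w' + b j * lo j) + J (Y w' + b j * hi j) + A w' + a j * hi j) := by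
      intro w hw w' hw'
      have l := hends w hw _ hlo
      have r := hends w hw _ hhi
      have l' := hends w' hw' _ hlo
      have r' := hends w' hw' _ hhi
      have s1 : ∀ y y' : ℝ, y + b j * lo j + (y' - y) = y' + b j * lo j := fun y y' => by ring
      have s2 : ∀ y : ℝ, y + b j * lo j + b j * (hi j - lo j) = y + b j * hi j :=
        fun y => by ring
      have s3 : ∀ y y' : ℝ, y + b j * lo j + (y' - y) + b j * (hi j - lo j) = y' + b j * hi j :=
        fun y y' => by ring
      rcases le_total 0 ((Y w' - Y w) * (b j * (hi j - lo j))) with hs | hs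
      · have := hh.map_add_add_map_add_le (Y w + b j * lo j) hs
        rw [s3, s1, s2] at this
        linarith
      · have hs' : 0 ≤ (Y w - Y w') * (b j * (hi j - lo j)) := by linarith
        have := hJ.map_add_add_map_add_le (Y w' + b j * lo j) hs'
        rw [s3, s1, s2] at this
        linarith
    obtain ⟨ζ, hζ₁, hζ₂⟩ : ∃ ζ : ℝ,
        (∀ w ∈ box, h (Y w + b j * hi j) + J (Y w + b j * lo j) + A w + a j * lo j - V
          ≤ ζ * (hi j - lo j)) ∧
        ∀ w ∈ box, ζ * (hi j - lo j) ≤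
          V - (h (Y w + b j * lo j) + J (Y w + b j * hi j) + A w + a j * hi j) := by
      rcases hjle.eq_or_lt with heq | hlt
      · refine ⟨0, fun w hw => ?_, fun w hw => ?_⟩
        · have := hends w hw _ hlo
          rw [← heq]
          linarith
        · have := hends w hw _ hlo
          rw [← heq]
          linarith
      · set X : Set ℝ := (fun w => h (Y w + b j * hi j) + J (Y w + b j * lo j) + A w
          + a j * lo j - V) '' box with hX
        have hlobox : lo ∈ box := fun i hi' => ⟨le_rfl, hle i (Finset.mem_insert_of_mem hi')⟩
        have hne : X.Nonempty := ⟨_, lo, hlobox, rfl⟩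
        have hub : ∀ w' ∈ box, ∀ x ∈ X, x ≤
            V - (h (Y w' + b j * lo j) + J (Y w' + b j * hi j) + A w' + a j * hi j) := by
          rintro w' hw' x ⟨w, hw, rfl⟩
          exact hpair w hw w' hw'
        have hδ : sSup X / (hi j - lo j) * (hi j - lo j) = sSup X :=
          div_mul_cancel₀ _ (sub_pos.2 hlt).ne'
        refine ⟨sSup X / (hi j - lo j), fun w hw => ?_, fun w hw => ?_⟩
        · rw [hδ]
          exact le_csSup ⟨_, hub lo hlobox⟩ ⟨w, hw, rfl⟩
        · rw [hδ]
          exact csSup_le hne (hub w hw)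
    obtain ⟨z₀, z, hz⟩ := ih (h := fun y => max (h (y + b j * lo j) + -(ζ * lo j))
        (h (y + b j * hi j) + -(ζ * hi j)))
      (J := fun y => max (J (y + b j * lo j) + (a j + ζ) * lo j)
        (J (y + b j * hi j) + (a j + ζ) * hi j))
      (fun i hi' => hle i (Finset.mem_insert_of_mem hi'))
      ((hh.comp_add_right_add_const _ _).sup (hh.comp_add_right_add_const _ _)) ((hJ.comp_add_right_add_const _ _).sup (hJ.comp_add_right_add_const _ _))
      (fun w hw => by
        have l := hends w hw _ hlo
        have r := hends w hw _ hhi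
        have c₁ := hζ₁ w hw
        have c₂ := hζ₂ w hw
        simp only [hA, hY] at l r c₁ c₂
        rcases max_choice (h (b₀ + ∑ i ∈ s, b i * w i + b j * lo j) + -(ζ * lo j))
          (h (b₀ + ∑ i ∈ s, b i * w i + b j * hi j) + -(ζ * hi j)) with m₁ | m₁ <;>
        rcases max_choice (J (b₀ + ∑ i ∈ s, b i * w i + b j * lo j) + (a j + ζ) * lo j)
          (J (b₀ + ∑ i ∈ s, b i * w i + b j * hi j) + (a j + ζ) * hi j) with m₂ | m₂ <;>
        rw [m₁, m₂] <;> linarith)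
    refine ⟨z₀, Function.update z j ζ, fun w hw => ?_⟩
    have hws : w ∈ box := fun i hi' => hw i (Finset.mem_insert_of_mem hi')
    have hwj := hw j (Finset.mem_insert_self j s)
    obtain ⟨hz₁, hz₂⟩ := hz w hws
    obtain ⟨h₁, h₂⟩ := max_le_iff.1 hz₁
    have h₃ := (add_le_add_right (le_max_left _ _) _).trans hz₂
    have h₄ := (add_le_add_right (le_max_right _ _) _).trans hz₂
    have hsum : ∑ i ∈ insert j s, Function.update z j ζ i * w i
        = ζ * w j + ∑ i ∈ s, z i * w i := by
      rw [Finset.sum_insert hj, Function.update_self]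
      congr 1
      refine Finset.sum_congr rfl fun i hi' => ?_
      rw [Function.update_of_ne (ne_of_mem_of_not_mem hi' hj)]
    have hinterp : ∀ {f : ℝ → ℝ}, ConvexOn ℝ Set.univ f → ∀ κ C : ℝ,
        f (Y w + b j * lo j) + κ * lo j ≤ C → f (Y w + b j * hi j) + κ * hi j ≤ C →
        f (Y w + b j * w j) + κ * w j ≤ C := by
      intro f hf κ C hl hr
      obtain ⟨α, β, hα, hβ, hαβ, hw'⟩ := (segment_eq_Icc (𝕜 := ℝ) hjle).symm ▸ hwj
      simp only [smul_eq_mul] at hw'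
      have hc := hf.2 (Set.mem_univ (Y w + b j * lo j)) (Set.mem_univ (Y w + b j * hi j))
        hα hβ hαβ
      simp only [smul_eq_mul] at hc
      have e : α * (Y w + b j * lo j) + β * (Y w + b j * hi j) = Y w + b j * w j := by
        rw [← hw']; linear_combination (Y w) * hαβ
      rw [e] at hc
      have hl' := mul_le_mul_of_nonneg_left hl hα
      have hr' := mul_le_mul_of_nonneg_left hr hβ
      have hC : α * C + β * C = C := by rw [← add_mul, hαβ, one_mul]
      rw [← hw'] at hc ⊢
      linarith
    rw [hsum, Finset.sum_insert hj, Finset.sum_insert hj]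
    have e1 : b₀ + (b j * w j + ∑ i ∈ s, b i * w i) = Y w + b j * w j := by simp only [hY]; ring
    rw [e1]
    constructor
    · have := hinterp hh (-ζ) (z₀ + ∑ i ∈ s, z i * w i) (by simp only [hY]; linarith)
        (by simp only [hY]; linarith)
      linarith
    · have := hinterp hJ (a j + ζ) (V - (a₀ + ∑ i ∈ s, a i * w i + (z₀ + ∑ i ∈ s, z i * w i)))
        (by simp only [hY]; linarith) (by simp only [hY]; linarith)
      linarith

/-- The Bellman operator on convex costs: the inner maximum is a convex function `G`, the outer
minimum is attained, and the resulting value function is convex. -/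
theorem bellman_spec {h J' J : ℝ → ℝ} (hh : ConvexOn ℝ Set.univ h)
    (hJ' : ConvexOn ℝ Set.univ J') {c L U lo hi : ℝ} (hLU : L ≤ U) (hle : lo ≤ hi)
    (hrec : ∀ x : ℝ, J x = sInf { y | ∃ u ∈ Set.Icc L U,
      y = c * u + sSup { z | ∃ w ∈ Set.Icc lo hi, z = h (x + u + w) + J' (x + u + w) } }) :
    ConvexOn ℝ Set.univ J ∧ ∃ G : ℝ → ℝ, ConvexOn ℝ Set.univ G ∧
      (∀ y, ∀ w ∈ Set.Icc lo hi, h (y + w) + J' (y + w) ≤ G y) ∧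
      (∀ y, ∃ w ∈ Set.Icc lo hi, G y = h (y + w) + J' (y + w)) ∧
      (∀ x, ∀ u ∈ Set.Icc L U, J x ≤ c * u + G (x + u)) ∧
      (∀ x, ∃ u ∈ Set.Icc L U, J x = c * u + G (x + u)) := by
  have hf : ConvexOn ℝ Set.univ (fun y => h y + J' y) := hh.add hJ'
  set G : ℝ → ℝ := fun y => max (h (y + lo) + J' (y + lo)) (h (y + hi) + J' (y + hi)) with hG
  have hGconv : ConvexOn ℝ Set.univ G := (hf.translate_left lo).sup (hf.translate_left hi)
  have hGle : ∀ y, ∀ w ∈ Set.Icc lo hi, h (y + w) + J' (y + w) ≤ G y := fun y w hw =>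
    hf.le_max_of_mem_Icc (Set.mem_univ (y + lo)) (Set.mem_univ (y + hi))
      ⟨by linarith [hw.1], by linarith [hw.2]⟩
  have hGatt : ∀ y, ∃ w ∈ Set.Icc lo hi, G y = h (y + w) + J' (y + w) := fun y => by
    rcases max_choice (h (y + lo) + J' (y + lo)) (h (y + hi) + J' (y + hi)) with e | e
    · exact ⟨lo, ⟨le_rfl, hle⟩, e⟩
    · exact ⟨hi, ⟨hle, le_rfl⟩, e⟩
  have hsup : ∀ y, sSup { z | ∃ w ∈ Set.Icc lo hi, z = h (y + w) + J' (y + w) } = G y :=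
    fun y => IsGreatest.csSup_eq ⟨hGatt y, by rintro z ⟨w, hw, rfl⟩; exact hGle y w hw⟩
  have hGcont : Continuous G := continuousOn_univ.1 (hGconv.continuousOn isOpen_univ)
  have hleast : ∀ x, IsLeast { y | ∃ u ∈ Set.Icc L U, y = c * u + G (x + u) } (J x) := fun x => by
    have hcont : Continuous fun u => c * u + G (x + u) := by fun_prop
    obtain ⟨u, hu, hmin⟩ := isCompact_Icc.exists_isMinOn (Set.nonempty_Icc.2 hLU)
      hcont.continuousOn
    have hl : IsLeast { y | ∃ u ∈ Set.Icc L U, y = c * u + G (x + u) } (c * u + G (x + u)) :=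
      ⟨⟨u, hu, rfl⟩, by rintro y ⟨u', hu', rfl⟩; exact hmin hu'⟩
    have hx := hrec x
    simp only [hsup] at hx
    rw [hx, hl.csInf_eq]
    exact hl
  have hJle : ∀ x, ∀ u ∈ Set.Icc L U, J x ≤ c * u + G (x + u) :=
    fun x u hu => (hleast x).2 ⟨u, hu, rfl⟩
  refine ⟨⟨convex_univ, fun x _ y _ α β hα hβ hαβ => ?_⟩, G, hGconv, hGle, hGatt, hJle,
    fun x => (hleast x).1⟩
  obtain ⟨u, hu, hxu⟩ := (hleast x).1
  obtain ⟨v, hv, hyv⟩ := (hleast y).1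
  have h1 := hJle (α • x + β • y) _ (convex_Icc L U hu hv hα hβ hαβ)
  have h2 := hGconv.2 (Set.mem_univ (x + u)) (Set.mem_univ (y + v)) hα hβ hαβ
  simp only [smul_eq_mul] at h1 h2 ⊢
  have e : α * x + β * y + (α * u + β * v) = α * (x + u) + β * (y + v) := by ring
  rw [e] at h1
  rw [hxu, hyv]
  linarith

/-- The value at `w` of the affine function of `w 1, …, w n` with constant term `r 0`. -/
def affineRow (r : ℕ → ℝ) (n : ℕ) (w : ℕ → ℝ) : ℝ := r 0 + ∑ t ∈ Finset.Icc 1 n, r t * w t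

/-- The state after `k` stages under the disturbance-affine policy `q`. -/
def affineState (x₁ : ℝ) (q : ℕ → ℕ → ℝ) (k : ℕ) (w : ℕ → ℝ) : ℝ :=
  x₁ + ∑ t ∈ Finset.Icc 1 k, (affineRow (q t) (t - 1) w + w t)

/-- The control cost plus the affine running cost accumulated over the first `k` stages. -/
def affineCost (c : ℕ → ℝ) (q z : ℕ → ℕ → ℝ) (k : ℕ) (w : ℕ → ℝ) : ℝ :=
  ∑ t ∈ Finset.Icc 1 k, (c t * affineRow (q t) (t - 1) w + affineRow (z t) t w)

theorem affineState_succ (x₁ : ℝ) (q : ℕ → ℕ → ℝ) (k : ℕ) (w : ℕ → ℝ) :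
    affineState x₁ q (k + 1) w
      = affineState x₁ q k w + affineRow (q (k + 1)) k w + w (k + 1) := by
  simp only [affineState, Finset.sum_Icc_succ_top (Nat.le_add_left 1 k), Nat.add_sub_cancel]
  ring

theorem affineCost_succ (c : ℕ → ℝ) (q z : ℕ → ℕ → ℝ) (k : ℕ) (w : ℕ → ℝ) :
    affineCost c q z (k + 1) w
      = affineCost c q z k w + c (k + 1) * affineRow (q (k + 1)) k w
        + affineRow (z (k + 1)) (k + 1) w := by
  simp only [affineCost, Finset.sum_Icc_succ_top (Nat.le_add_left 1 k), Nat.add_sub_cancel]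
  ring

theorem affineRow_congr_right (r : ℕ → ℝ) {n : ℕ} {w w' : ℕ → ℝ}
    (hw : ∀ t, 1 ≤ t → t ≤ n → w t = w' t) : affineRow r n w = affineRow r n w' := by
  unfold affineRow
  congr 1
  refine Finset.sum_congr rfl fun t ht => ?_
  rw [Finset.mem_Icc] at ht
  rw [hw t ht.1 ht.2]

theorem affineState_congr (x₁ : ℝ) {q q' : ℕ → ℕ → ℝ} {k : ℕ} {w w' : ℕ → ℝ}
    (hq : ∀ t, 1 ≤ t → t ≤ k → q t = q' t) (hw : ∀ t, 1 ≤ t → t ≤ k → w t = w' t) :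
    affineState x₁ q k w = affineState x₁ q' k w' := by
  unfold affineState
  congr 1
  refine Finset.sum_congr rfl fun t ht => ?_
  rw [Finset.mem_Icc] at ht
  rw [hq t ht.1 ht.2, hw t ht.1 ht.2,
    affineRow_congr_right (q' t) fun i hi hi' => hw i hi (by omega)]

theorem affineCost_congr (c : ℕ → ℝ) {q q' z z' : ℕ → ℕ → ℝ} {k : ℕ} {w w' : ℕ → ℝ}
    (hq : ∀ t, 1 ≤ t → t ≤ k → q t = q' t) (hz : ∀ t, 1 ≤ t → t ≤ k → z t = z' t)
    (hw : ∀ t, 1 ≤ t → t ≤ k → w t = w' t) :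
    affineCost c q z k w = affineCost c q' z' k w' := by
  unfold affineCost
  refine Finset.sum_congr rfl fun t ht => ?_
  rw [Finset.mem_Icc] at ht
  rw [hq t ht.1 ht.2, hz t ht.1 ht.2,
    affineRow_congr_right (q' t) fun i hi hi' => hw i hi (by omega),
    affineRow_congr_right (z' t) fun i hi hi' => hw i hi (by omega)]

/-- A function of the disturbances that is affine in `w 1, …, w n`. -/
def IsAffineUpTo (n : ℕ) (f : (ℕ → ℝ) → ℝ) : Prop := ∃ r : ℕ → ℝ, ∀ w, f w = affineRow r n w

theorem isAffineUpTo_affineRow (r : ℕ → ℝ) (n : ℕ) : IsAffineUpTo n (affineRow r n) :=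
  ⟨r, fun _ => rfl⟩

theorem isAffineUpTo_const (n : ℕ) (κ : ℝ) : IsAffineUpTo n fun _ => κ :=
  ⟨fun t => if t = 0 then κ else 0, fun w => by simp [affineRow]⟩

theorem isAffineUpTo_apply {n t : ℕ} (h1 : 1 ≤ t) (hn : t ≤ n) : IsAffineUpTo n fun w => w t :=
  ⟨fun i => if i = t then 1 else 0, fun w => by
    have ht : t ≠ 0 := by omega
    simp [affineRow, ht.symm, h1, hn]⟩

theorem IsAffineUpTo.add {n : ℕ} {f g : (ℕ → ℝ) → ℝ} (hf : IsAffineUpTo n f)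
    (hg : IsAffineUpTo n g) : IsAffineUpTo n fun w => f w + g w := by
  obtain ⟨r, hr⟩ := hf
  obtain ⟨r', hr'⟩ := hg
  refine ⟨fun t => r t + r' t, fun w => ?_⟩
  simp only [hr, hr', affineRow, add_mul, Finset.sum_add_distrib]
  ring

theorem IsAffineUpTo.const_mul {n : ℕ} {f : (ℕ → ℝ) → ℝ} (hf : IsAffineUpTo n f) (κ : ℝ) :
    IsAffineUpTo n fun w => κ * f w := by
  obtain ⟨r, hr⟩ := hf
  refine ⟨fun t => κ * r t, fun w => ?_⟩
  simp only [hr, affineRow, mul_add, Finset.mul_sum, mul_assoc]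

theorem IsAffineUpTo.succ {n : ℕ} {f : (ℕ → ℝ) → ℝ} (hf : IsAffineUpTo n f) :
    IsAffineUpTo (n + 1) f := by
  obtain ⟨r, hr⟩ := hf
  refine ⟨Function.update r (n + 1) 0, fun w => ?_⟩
  rw [hr, affineRow, affineRow, Finset.sum_Icc_succ_top (Nat.le_add_left 1 n),
    Function.update_self, Function.update_of_ne (Nat.succ_ne_zero n).symm, zero_mul, add_zero]
  congr 1
  refine Finset.sum_congr rfl fun t ht => ?_
  rw [Function.update_of_ne (by have := (Finset.mem_Icc.1 ht).2; omega)]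

theorem isAffineUpTo_affineState (x₁ : ℝ) (q : ℕ → ℕ → ℝ) (k : ℕ) :
    IsAffineUpTo k (affineState x₁ q k) := by
  induction k with
  | zero =>
    obtain ⟨r, hr⟩ := isAffineUpTo_const 0 x₁
    exact ⟨r, fun w => by rw [← hr]; simp [affineState]⟩
  | succ k ih =>
    rw [funext (affineState_succ x₁ q k)]
    exact (ih.add (isAffineUpTo_affineRow _ k)).succ.add
      (isAffineUpTo_apply (Nat.le_add_left 1 k) le_rfl)

theorem isAffineUpTo_affineCost (c : ℕ → ℝ) (q z : ℕ → ℕ → ℝ) (k : ℕ) :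
    IsAffineUpTo k (affineCost c q z k) := by
  induction k with
  | zero =>
    obtain ⟨r, hr⟩ := isAffineUpTo_const 0 0
    exact ⟨r, fun w => by rw [← hr]; simp [affineCost]⟩
  | succ k ih =>
    rw [funext (affineCost_succ c q z k)]
    exact (ih.add ((isAffineUpTo_affineRow _ k).const_mul _)).succ.add
      (isAffineUpTo_affineRow _ (k + 1))

/-- Packing a constant term and coefficients into a single row. -/
theorem affineRow_ite (r₀ : ℝ) (r : ℕ → ℝ) (n : ℕ) (w : ℕ → ℝ) :
    affineRow (fun t => if t = 0 then r₀ else r t) n w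
      = r₀ + ∑ t ∈ Finset.Icc 1 n, r t * w t := by
  simp only [affineRow, if_true]
  congr 1
  refine Finset.sum_congr rfl fun t ht => ?_
  rw [if_neg (by have := (Finset.mem_Icc.1 ht).1; omega)]

/-- `exists_affine_control` for affine functions of the first `n` disturbances, with a linear
control cost. -/
theorem IsAffineUpTo.exists_control {n : ℕ} {lo hi : ℕ → ℝ}
    (hle : ∀ t, 1 ≤ t → t ≤ n → lo t ≤ hi t) {A Y : (ℕ → ℝ) → ℝ} (hA : IsAffineUpTo n A)
    (hY : IsAffineUpTo n Y) {g : ℝ → ℝ} (hg : ConvexOn ℝ Set.univ g) {c L U V : ℝ}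
    (H : ∀ w : ℕ → ℝ, (∀ t, 1 ≤ t → t ≤ n → w t ∈ Set.Icc (lo t) (hi t)) →
      ∃ u ∈ Set.Icc L U, A w + (c * u + g (Y w + u)) ≤ V) :
    ∃ r : ℕ → ℝ, ∀ w : ℕ → ℝ, (∀ t, 1 ≤ t → t ≤ n → w t ∈ Set.Icc (lo t) (hi t)) →
      affineRow r n w ∈ Set.Icc L U ∧
      A w + (c * affineRow r n w + g (Y w + affineRow r n w)) ≤ V := by
  obtain ⟨a, ha⟩ := hA.add (hY.const_mul (-c))
  obtain ⟨b, hb⟩ := hY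
  have hgc : ConvexOn ℝ Set.univ fun y => g y + c * y := by
    refine hg.add ⟨convex_univ, fun x _ y _ α β _ _ _ => le_of_eq ?_⟩
    simp only [smul_eq_mul]
    ring
  obtain ⟨q₀, q, hq⟩ := exists_affine_control (Finset.Icc 1 n) lo hi a b
    (fun t ht => hle t (Finset.mem_Icc.1 ht).1 (Finset.mem_Icc.1 ht).2) hgc
    (L := L) (U := U) (a₀ := a 0) (b₀ := b 0) (V := V)
    (fun w hw => by
      obtain ⟨u, hu, h⟩ := H w fun t h1 h2 => hw t (Finset.mem_Icc.2 ⟨h1, h2⟩)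
      refine ⟨u, hu, ?_⟩
      change affineRow a n w + (g (affineRow b n w + u) + c * (affineRow b n w + u)) ≤ V
      rw [← ha, ← hb]
      linarith)
  refine ⟨fun t => if t = 0 then q₀ else q t, fun w hw => ?_⟩
  rw [affineRow_ite]
  obtain ⟨h1, h2⟩ := hq w fun t ht => hw t (Finset.mem_Icc.1 ht).1 (Finset.mem_Icc.1 ht).2
  refine ⟨h1, ?_⟩
  set u := q₀ + ∑ t ∈ Finset.Icc 1 n, q t * w t
  change affineRow a n w + (g (affineRow b n w + u) + c * (affineRow b n w + u)) ≤ V at h2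
  rw [← ha, ← hb] at h2
  linarith

/-- `exists_affine_cost` for affine functions of the first `n` disturbances. -/
theorem IsAffineUpTo.exists_cost {n : ℕ} {lo hi : ℕ → ℝ}
    (hle : ∀ t, 1 ≤ t → t ≤ n → lo t ≤ hi t) {A Y : (ℕ → ℝ) → ℝ} (hA : IsAffineUpTo n A)
    (hY : IsAffineUpTo n Y) {h J : ℝ → ℝ} (hh : ConvexOn ℝ Set.univ h)
    (hJ : ConvexOn ℝ Set.univ J) {V : ℝ}
    (H : ∀ w : ℕ → ℝ, (∀ t, 1 ≤ t → t ≤ n → w t ∈ Set.Icc (lo t) (hi t)) →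
      A w + h (Y w) + J (Y w) ≤ V) :
    ∃ r : ℕ → ℝ, ∀ w : ℕ → ℝ, (∀ t, 1 ≤ t → t ≤ n → w t ∈ Set.Icc (lo t) (hi t)) →
      h (Y w) ≤ affineRow r n w ∧ A w + affineRow r n w + J (Y w) ≤ V := by
  obtain ⟨a, ha⟩ := hA
  obtain ⟨b, hb⟩ := hY
  simp only [ha, hb] at H ⊢
  obtain ⟨z₀, z, hz⟩ := exists_affine_cost (Finset.Icc 1 n) lo hi a b
    (fun t ht => hle t (Finset.mem_Icc.1 ht).1 (Finset.mem_Icc.1 ht).2) hh hJ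
    (a₀ := a 0) (b₀ := b 0) (V := V)
    (fun w hw => H w fun t h1 h2 => hw t (Finset.mem_Icc.2 ⟨h1, h2⟩))
  refine ⟨fun t => if t = 0 then z₀ else z t, fun w hw => ?_⟩
  rw [affineRow_ite]
  exact hz w fun t ht => hw t (Finset.mem_Icc.1 ht).1 (Finset.mem_Icc.1 ht).2

/-- Optimality of affine policies and affine cost relaxations for the
one-dimensional multi-stage robust (min-max) control problem, stated via the
dynamic-programming value functions `J`. -/
theorem affine_policies_and_costs_optimal
    (T : ℕ) (hT : 1 ≤ T) (x1 : ℝ)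
    (h : ℕ → ℝ → ℝ) (c L U wlo whi : ℕ → ℝ)
    (hconv : ∀ k, 1 ≤ k → k ≤ T → ConvexOn ℝ Set.univ (h k))
    (hcoer : ∀ k, 1 ≤ k → k ≤ T →
      Filter.Tendsto (h k) (Filter.cocompact ℝ) Filter.atTop)
    (hc : ∀ k, 1 ≤ k → k ≤ T → 0 ≤ c k)
    (hLU : ∀ k, 1 ≤ k → k ≤ T → L k ≤ U k)
    (hw : ∀ k, 1 ≤ k → k ≤ T → wlo k ≤ whi k)
    (J : ℕ → ℝ → ℝ)
    (hJend : ∀ x : ℝ, J (T + 1) x = 0)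
    (hJrec : ∀ k, 1 ≤ k → k ≤ T → ∀ x : ℝ,
      J k x = sInf { y | ∃ u ∈ Set.Icc (L k) (U k),
        y = c k * u + sSup { z | ∃ w ∈ Set.Icc (wlo k) (whi k),
          z = h k (x + u + w) + J (k + 1) (x + u + w) } }) :
    ∃ q z : ℕ → ℕ → ℝ, ∀ k, 1 ≤ k → k ≤ T →
      -- (i) robust feasibility of the affine control policy
      (∀ w : ℕ → ℝ, (∀ t, 1 ≤ t → t ≤ k - 1 → w t ∈ Set.Icc (wlo t) (whi t)) →
          q k 0 + ∑ t ∈ Finset.Icc 1 (k - 1), q k t * w t ∈ Set.Icc (L k) (U k)) ∧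
      -- (ii) the affine running cost dominates the convex state cost
      (∀ w : ℕ → ℝ, (∀ t, 1 ≤ t → t ≤ k → w t ∈ Set.Icc (wlo t) (whi t)) →
          h k (x1 + ∑ t ∈ Finset.Icc 1 k,
              ((q t 0 + ∑ τ ∈ Finset.Icc 1 (t - 1), q t τ * w τ) + w t))
            ≤ z k 0 + ∑ t ∈ Finset.Icc 1 k, z k t * w t) ∧
      -- (iii) the overall min-max value is preserved
      IsGreatest
        { v | ∃ w : ℕ → ℝ,
            (∀ t, 1 ≤ t → t ≤ k → w t ∈ Set.Icc (wlo t) (whi t)) ∧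
            v = (∑ t ∈ Finset.Icc 1 k,
                  (c t * (q t 0 + ∑ τ ∈ Finset.Icc 1 (t - 1), q t τ * w τ)
                    + (z t 0 + ∑ τ ∈ Finset.Icc 1 t, z t τ * w τ)))
              + J (k + 1) (x1 + ∑ t ∈ Finset.Icc 1 k,
                  ((q t 0 + ∑ τ ∈ Finset.Icc 1 (t - 1), q t τ * w τ) + w t)) }
        (J 1 x1) := by
  have hJconv : ∀ k, 1 ≤ k → k ≤ T + 1 → ConvexOn ℝ Set.univ (J k) := by
    intro k hk hkT
    induction hkT using Nat.decreasingInduction with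
    | self => exact (convexOn_const 0 convex_univ).congr fun x _ => (hJend x).symm
    | of_succ k hkT ih =>
      have hkT' : k ≤ T := by omega
      exact (bellman_spec (hconv k hk hkT') (ih (by omega)) (hLU k hk hkT') (hw k hk hkT')
        (hJrec k hk hkT')).1
  have hspec : ∀ k, 1 ≤ k → k ≤ T → _ := fun k hk hkT =>
    (bellman_spec (hconv k hk hkT) (hJconv (k + 1) (by omega) (by omega)) (hLU k hk hkT)
      (hw k hk hkT) (hJrec k hk hkT)).2
  have hupper : ∀ n, n ≤ T → ∃ q z : ℕ → ℕ → ℝ,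
      (∀ k, 1 ≤ k → k ≤ n →
        (∀ w : ℕ → ℝ, (∀ t, 1 ≤ t → t ≤ k - 1 → w t ∈ Set.Icc (wlo t) (whi t)) →
          affineRow (q k) (k - 1) w ∈ Set.Icc (L k) (U k)) ∧
        (∀ w : ℕ → ℝ, (∀ t, 1 ≤ t → t ≤ k → w t ∈ Set.Icc (wlo t) (whi t)) →
          h k (affineState x1 q k w) ≤ affineRow (z k) k w)) ∧
      ∀ k, k ≤ n → ∀ w : ℕ → ℝ, (∀ t, 1 ≤ t → t ≤ k → w t ∈ Set.Icc (wlo t) (whi t)) →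
        affineCost c q z k w + J (k + 1) (affineState x1 q k w) ≤ J 1 x1 := by
    intro n
    induction n with
    | zero =>
      intro _
      refine ⟨fun _ _ => 0, fun _ _ => 0, fun k hk hk' => by omega, fun k hk w _ => ?_⟩
      obtain rfl : k = 0 := by omega
      simp [affineCost, affineState]
    | succ n ih =>
      intro hnT
      obtain ⟨q, z, hqz, hcost⟩ := ih (by omega)
      have hn1 : 1 ≤ n + 1 := Nat.le_add_left 1 n
      obtain ⟨G, hGconv, hGle, -, -, hGu⟩ := hspec (n + 1) hn1 hnT
      obtain ⟨r, hr⟩ := IsAffineUpTo.exists_control (n := n)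
        (fun t h1 h2 => hw t h1 (by omega)) (isAffineUpTo_affineCost c q z n)
        (isAffineUpTo_affineState x1 q n) hGconv (c := c (n + 1)) (L := L (n + 1))
        (U := U (n + 1)) (V := J 1 x1) (fun w hwb => by
          obtain ⟨u, hu, hJu⟩ := hGu (affineState x1 q n w)
          exact ⟨u, hu, hJu ▸ hcost n le_rfl w hwb⟩)
      obtain ⟨ρ, hρ⟩ := IsAffineUpTo.exists_cost (n := n + 1)
        (fun t h1 h2 => hw t h1 (by omega))
        ((isAffineUpTo_affineCost c q z n).add
          ((isAffineUpTo_affineRow r n).const_mul (c (n + 1)))).succ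
        (((isAffineUpTo_affineState x1 q n).add (isAffineUpTo_affineRow r n)).succ.add
          (isAffineUpTo_apply hn1 le_rfl))
        (hconv (n + 1) hn1 hnT) (hJconv (n + 1 + 1) (by omega) (by omega)) (V := J 1 x1)
        (fun w hwb => by
          have h1 := (hr w fun t h1 h2 => hwb t h1 (by omega)).2
          have h2 := hGle (affineState x1 q n w + affineRow r n w) _ (hwb (n + 1) hn1 le_rfl)
          linarith)
      have hq' : ∀ t, 1 ≤ t → t ≤ n → Function.update q (n + 1) r t = q t :=
        fun t _ ht => Function.update_of_ne (by omega) _ _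
      have hz' : ∀ t, 1 ≤ t → t ≤ n → Function.update z (n + 1) ρ t = z t :=
        fun t _ ht => Function.update_of_ne (by omega) _ _
      have hstate : ∀ k, k ≤ n → ∀ w, affineState x1 (Function.update q (n + 1) r) k w
          = affineState x1 q k w := fun k hk w =>
        affineState_congr x1 (fun t h1 h2 => hq' t h1 (by omega)) fun _ _ _ => rfl
      have hcost' : ∀ k, k ≤ n → ∀ w, affineCost c (Function.update q (n + 1) r)
          (Function.update z (n + 1) ρ) k w = affineCost c q z k w := fun k hk w =>
        affineCost_congr c (fun t h1 h2 => hq' t h1 (by omega))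
          (fun t h1 h2 => hz' t h1 (by omega)) fun _ _ _ => rfl
      refine ⟨Function.update q (n + 1) r, Function.update z (n + 1) ρ, fun k hk hkn => ?_,
        fun k hkn w hwb => ?_⟩
      · rcases Nat.le_succ_iff.1 hkn with hkn' | rfl
        · rw [hq' k hk hkn', hz' k hk hkn']
          simp only [hstate k hkn']
          exact hqz k hk hkn'
        · simp only [affineState_succ, hstate n le_rfl, Function.update_self]
          exact ⟨fun w hwb => (hr w hwb).1, fun w hwb => (hρ w hwb).1⟩
      · rcases Nat.le_succ_iff.1 hkn with hkn' | rfl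
        · rw [hstate k hkn', hcost' k hkn']
          exact hcost k hkn' w hwb
        · rw [affineState_succ, affineCost_succ, hstate n le_rfl, hcost' n le_rfl,
            Function.update_self, Function.update_self]
          exact (hρ w hwb).2
  obtain ⟨q, z, hqz, hcost⟩ := hupper T le_rfl
  have hlower : ∀ k, k ≤ T → ∃ w : ℕ → ℝ,
      (∀ t, 1 ≤ t → t ≤ k → w t ∈ Set.Icc (wlo t) (whi t)) ∧
      J 1 x1 ≤ affineCost c q z k w + J (k + 1) (affineState x1 q k w) := by
    intro k
    induction k with
    | zero =>
      intro _
      exact ⟨fun _ => 0, fun t h1 h2 => by omega, by simp [affineCost, affineState]⟩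
    | succ k ih =>
      intro hkT
      obtain ⟨w, hwb, hval⟩ := ih (by omega)
      have hk1 : 1 ≤ k + 1 := Nat.le_add_left 1 k
      obtain ⟨G, -, -, hGatt, hGJ, -⟩ := hspec (k + 1) hk1 hkT
      obtain ⟨hfeas, hdom⟩ := hqz (k + 1) hk1 hkT
      set u := affineRow (q (k + 1)) k w with hu
      obtain ⟨v, hv, hGv⟩ := hGatt (affineState x1 q k w + u)
      have hagree : ∀ t, 1 ≤ t → t ≤ k → Function.update w (k + 1) v t = w t :=
        fun t _ ht => Function.update_of_ne (by omega) _ _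
      have hbox : ∀ t, 1 ≤ t → t ≤ k + 1 →
          Function.update w (k + 1) v t ∈ Set.Icc (wlo t) (whi t) := by
        intro t h1 h2
        rcases Nat.le_succ_iff.1 h2 with h2' | rfl
        · rw [hagree t h1 h2']
          exact hwb t h1 h2'
        · rwa [Function.update_self]
      have hstate : affineState x1 q (k + 1) (Function.update w (k + 1) v)
          = affineState x1 q k w + u + v := by
        rw [affineState_succ, Function.update_self, affineRow_congr_right _ hagree,
          affineState_congr x1 (fun _ _ _ => rfl) hagree]
      have hz := hdom _ hbox
      rw [hstate] at hz
      refine ⟨Function.update w (k + 1) v, hbox, ?_⟩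
      rw [hstate, affineCost_succ, affineRow_congr_right (q (k + 1)) hagree,
        affineCost_congr c (fun _ _ _ => rfl) (fun _ _ _ => rfl) hagree, ← hu]
      have hJu := hGJ (affineState x1 q k w) u (hfeas w hwb)
      linarith
  refine ⟨q, z, fun k hk hkT => ⟨(hqz k hk hkT).1, (hqz k hk hkT).2, ?_, ?_⟩⟩
  · obtain ⟨w, hwb, hle⟩ := hlower k hkT
    exact ⟨w, hwb, le_antisymm hle (hcost k hkT w hwb)⟩
  · rintro v ⟨w, hwb, rfl⟩
    exact hcost k hkT w hwb
end

section
/- Let T ≥ 1, x₁ ∈ ℝ, and for each k ∈ {1,…,T} let h_k : ℝ → ℝ be convex and coercive, c_k ≥ 0, L_k ≤ U_k, w̲_k ≤ w̄_k, and let J_1 be the dynamic-programming value function (J_{T+1} ≡ 0, J_k(x) = min_{u∈[L_k,U_k]} [c_k·u + max_{w∈[w̲_k,w̄_k]} (h_k(x+u+w) + J_{k+1}(x+u+w))]). Then there exist affine functions q_k(w₁,…,w_{k−1}) = q_{k,0} + Σ_{t<k} q_{k,t}·w_t, k = 1,…,T, satisfying L_k ≤ q_k(w₁,…,w_{k−1})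 ≤ U_k for all disturbances in the box ∏_{t<k}[w̲_t,w̄_t], such that max over (w₁,…,w_T) ∈ ∏_{t=1}^T [w̲_t,w̄_t] of Σ_{t=1}^T [ c_t·q_t(w₁,…,w_{t−1}) + h_t( x₁ + Σ_{τ=1}^{t} (q_τ(w₁,…,w_{τ−1}) + w_τ) ) ] = J_1(x₁). That is, disturbance-affine control policies are optimal for the min-max problem. -/
/-- For a convex function on the line, increments over a fixed step are nondecreasing. -/
lemma ConvexOn.add_sub_le_add_sub {f : ℝ → ℝ} (hf : ConvexOn ℝ Set.univ f) {x y d : ℝ}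
    (hxy : x ≤ y) (hd : 0 ≤ d) : f (x + d) + f y ≤ f x + f (y + d) := by
  rcases hd.eq_or_lt with rfl | hd
  · simp
  have hpos : 0 < y - x + d := by linarith
  have hne : y - x + d ≠ 0 := hpos.ne'
  have ha : 0 ≤ (y - x) / (y - x + d) := div_nonneg (by linarith) hpos.le
  have hb : 0 ≤ d / (y - x + d) := div_nonneg hd.le hpos.le
  have hab : (y - x) / (y - x + d) + d / (y - x + d) = 1 := by field_simp
  have h1 := hf.2 (Set.mem_univ x) (Set.mem_univ (y + d)) ha hb hab
  have h2 := hf.2 (Set.mem_univ x) (Set.mem_univ (y + d)) hb ha (by rw [add_comm, hab])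
  have e1 : ((y - x) / (y - x + d)) • x + (d / (y - x + d)) • (y + d) = x + d := by
    simp only [smul_eq_mul]; field_simp; ring
  have e2 : (d / (y - x + d)) • x + ((y - x) / (y - x + d)) • (y + d) = y := by
    simp only [smul_eq_mul]; field_simp; ring
  rw [e1] at h1
  rw [e2] at h2
  have e3 : ((y - x) / (y - x + d)) • f x + (d / (y - x + d)) • f (y + d)
      + ((d / (y - x + d)) • f x + ((y - x) / (y - x + d)) • f (y + d)) = f x + f (y + d) := by
    simp only [smul_eq_mul]; field_simp; ring
  linarith

/-- Minimising a convex function over a sliding window `[x + L, x + U]`: the least minimiser is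
nondecreasing in `x` and moves at most as fast as the window. -/
lemma ConvexOn.exists_window_argmin {G : ℝ → ℝ} (hG : ConvexOn ℝ Set.univ G) {L U : ℝ}
    (hLU : L ≤ U) :
    ∃ Y : ℝ → ℝ, Monotone Y ∧ Monotone (fun x => x - Y x) ∧
      (∀ x, Y x - x ∈ Set.Icc L U) ∧
      ∀ x, ∀ u ∈ Set.Icc L U, G (Y x) ≤ G (x + u) := by
  have hcont : Continuous G := by
    rw [← continuousOn_univ]; exact hG.continuousOn isOpen_univ
  have hleast : ∀ x : ℝ, ∃ m, IsLeast {y ∈ Set.Icc (x + L) (x + U) |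
      ∀ z ∈ Set.Icc (x + L) (x + U), G y ≤ G z} m := by
    intro x
    obtain ⟨m, hm, hmin⟩ := (isCompact_Icc (a := x + L) (b := x + U)).exists_isMinOn
      (Set.nonempty_Icc.2 (by linarith)) hcont.continuousOn
    refine IsCompact.exists_isLeast ?_ ⟨m, hm, fun z hz => hmin hz⟩
    refine isCompact_Icc.of_isClosed_subset ?_ (Set.sep_subset _ _)
    have : {y ∈ Set.Icc (x + L) (x + U) | ∀ z ∈ Set.Icc (x + L) (x + U), G y ≤ G z}
        = Set.Icc (x + L) (x + U) ∩ {y | G y ≤ G m} := by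
      ext y
      constructor
      · rintro ⟨h1, h2⟩
        exact ⟨h1, h2 m hm⟩
      · rintro ⟨h1, h2⟩
        exact ⟨h1, fun z hz => le_trans h2 (hmin hz)⟩
    rw [this]
    exact isClosed_Icc.inter (isClosed_le hcont continuous_const)
  choose Y hY using hleast
  have hlo : ∀ x, x + L ≤ Y x := fun x => (hY x).1.1.1
  have hhi : ∀ x, Y x ≤ x + U := fun x => (hY x).1.1.2
  have hmin : ∀ x z, x + L ≤ z → z ≤ x + U → G (Y x) ≤ G z :=
    fun x z h1 h2 => (hY x).1.2 z ⟨h1, h2⟩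
  have hlt : ∀ x z, x + L ≤ z → z < Y x → G (Y x) < G z := by
    intro x z h1 h2
    by_contra hcon
    have hz : z ≤ x + U := h2.le.trans (hhi x)
    exact absurd ((hY x).2 ⟨⟨h1, hz⟩, fun y hy =>
      (not_lt.1 hcon).trans (hmin x y hy.1 hy.2)⟩) (not_le.2 h2)
  refine ⟨Y, ?_, ?_, fun x => ⟨by linarith [hlo x], by linarith [hhi x]⟩,
    fun x u hu => hmin x _ (by linarith [hu.1]) (by linarith [hu.2])⟩
  · intro x x' hxx
    by_contra hcon
    push Not at hcon
    have h1 := hlt x (Y x') (by linarith [hlo x']) hcon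
    have h2 := hmin x' (Y x) (by linarith [hlo x']) (by linarith [hhi x])
    linarith
  · intro x x' hxx
    by_contra hcon
    simp only [not_le] at hcon
    have h1 := hlt x' (Y x + (x' - x)) (by linarith [hlo x]) (by linarith)
    have h2 := hmin x (Y x' - (x' - x)) (by linarith [hlo x]) (by linarith [hhi x'])
    have h3 := hG.add_sub_le_add_sub (x := Y x) (y := Y x' - (x' - x)) (d := x' - x)
      (by linarith) (by linarith)
    rw [sub_add_cancel] at h3
    linarith

/-- One step of the robust dynamic-programming recursion with convex cost-to-go `f`. -/
lemma exists_robust_step {f J : ℝ → ℝ} (hf : ConvexOn ℝ Set.univ f) {c L U lo hi : ℝ}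
    (hLU : L ≤ U) (hw : lo ≤ hi)
    (hJ : ∀ x, J x = sInf { y | ∃ u ∈ Set.Icc L U,
      y = c * u + sSup { z | ∃ w ∈ Set.Icc lo hi, z = f (x + u + w) } }) :
    ∃ Y : ℝ → ℝ, Monotone Y ∧ Monotone (fun x => x - Y x) ∧
      (∀ x, Y x - x ∈ Set.Icc L U) ∧ ConvexOn ℝ Set.univ J ∧
      (∀ x, ∀ w ∈ Set.Icc lo hi, c * (Y x - x) + f (Y x + w) ≤ J x) ∧
      (∀ x, ∀ u ∈ Set.Icc L U, ∃ w ∈ Set.Icc lo hi, J x ≤ c * u + f (x + u + w)) := by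
  set g : ℝ → ℝ := fun y => max (f (y + lo)) (f (y + hi)) with hg
  have htr : ∀ a : ℝ, ConvexOn ℝ Set.univ fun y => f (y + a) := fun a => by
    simpa [Function.comp_def] using hf.translate_left a
  have hgconv : ConvexOn ℝ Set.univ g := (htr lo).sup (htr hi)
  have hgle : ∀ y, ∀ w ∈ Set.Icc lo hi, f (y + w) ≤ g y := fun y w hw' =>
    hf.le_max_of_mem_Icc (Set.mem_univ _) (Set.mem_univ _)
      ⟨by linarith [hw'.1], by linarith [hw'.2]⟩
  have hgatt : ∀ y, ∃ w ∈ Set.Icc lo hi, g y = f (y + w) := fun y => by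
    rcases max_choice (f (y + lo)) (f (y + hi)) with h | h
    · exact ⟨lo, ⟨le_rfl, hw⟩, h⟩
    · exact ⟨hi, ⟨hw, le_rfl⟩, h⟩
  have hsup : ∀ y, sSup { z | ∃ w ∈ Set.Icc lo hi, z = f (y + w) } = g y := fun y =>
    IsGreatest.csSup_eq ⟨hgatt y, by rintro z ⟨w, hw', rfl⟩; exact hgle y w hw'⟩
  have hGconv : ConvexOn ℝ Set.univ fun y => c * y + g y := by
    refine ConvexOn.add ⟨convex_univ, fun x _ y _ a b _ _ _ => ?_⟩ hgconv
    simp only [smul_eq_mul]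
    apply le_of_eq; ring
  obtain ⟨Y, hmono, hlip, hmem, hmin⟩ := hGconv.exists_window_argmin hLU
  have hle : ∀ x, ∀ u ∈ Set.Icc L U, c * (Y x - x) + g (Y x) ≤ c * u + g (x + u) := by
    intro x u hu
    have := hmin x u hu
    linarith
  have hJY : ∀ x, J x = c * (Y x - x) + g (Y x) := by
    intro x
    rw [hJ x]
    refine IsLeast.csInf_eq ⟨⟨Y x - x, hmem x, ?_⟩, ?_⟩
    · rw [hsup, add_sub_cancel]
    · rintro y ⟨u, hu, rfl⟩
      rw [hsup]
      exact hle x u hu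
  refine ⟨Y, hmono, hlip, hmem, ⟨convex_univ, ?_⟩, ?_, ?_⟩
  · intro x _ y _ a b ha hb hab
    have h1 := hle (a • x + b • y) (a * (Y x - x) + b * (Y y - y))
      ((convex_Icc L U) (hmem x) (hmem y) ha hb hab)
    have h2 := hgconv.2 (Set.mem_univ (Y x)) (Set.mem_univ (Y y)) ha hb hab
    simp only [smul_eq_mul] at h1 h2 ⊢
    rw [hJY, hJY x, hJY y]
    have e : a * x + b * y + (a * (Y x - x) + b * (Y y - y)) = a * Y x + b * Y y := by ring
    rw [e] at h1
    linarith
  · intro x w hw'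
    rw [hJY]
    linarith [hgle (Y x) w hw']
  · intro x u hu
    obtain ⟨w, hw', hwe⟩ := hgatt (x + u)
    exact ⟨w, hw', by rw [hJY, ← hwe]; exact hle x u hu⟩

/-- If every point of a convex set makes some member of a finite family of affine functions at
most `V`, then some convex combination of the family is at most `V` on the whole set. -/
lemma exists_convex_combination_le {ι E : Type*} [Fintype ι] [AddCommGroup E] [Module ℝ E]
    {K : Set E} (hK : Convex ℝ K) (hne : K.Nonempty) (Z : ι → E → ℝ) (V : ℝ)
    (hZ : ∀ i x y (a b : ℝ), a + b = 1 → Z i (a • x + b • y) = a * Z i x + b * Z i y)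
    (hmin : ∀ x ∈ K, ∃ i, Z i x ≤ V) :
    ∃ l : ι → ℝ, (∀ i, 0 ≤ l i) ∧ ∑ i, l i = 1 ∧ ∀ x ∈ K, ∑ i, l i * Z i x ≤ V := by
  classical
  have hopen : IsOpen {v : ι → ℝ | ∀ i, V < v i} := by
    simp only [Set.ofPred_forall]
    exact isOpen_iInter_of_finite fun i => isOpen_lt continuous_const (continuous_apply i)
  have hconv : Convex ℝ {v : ι → ℝ | ∀ i, V < v i} := by
    intro v hv w hw a b ha hb hab i
    exact (convex_Ioi V) (hv i) (hw i) ha hb hab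
  have himg : Convex ℝ ((fun x i => Z i x) '' K) := by
    rintro _ ⟨x, hx, rfl⟩ _ ⟨y, hy, rfl⟩ a b ha hb hab
    refine ⟨a • x + b • y, hK hx hy ha hb hab, ?_⟩
    funext i
    simp [hZ i x y a b hab]
  have hdisj : Disjoint {v : ι → ℝ | ∀ i, V < v i} ((fun x i => Z i x) '' K) := by
    rw [Set.disjoint_left]
    rintro _ hv ⟨x, hx, rfl⟩
    obtain ⟨i, hi⟩ := hmin x hx
    exact absurd (hv i) (not_lt.2 hi)
  obtain ⟨F, u, hFs, hFt⟩ := geometric_hahn_banach_open hconv hopen himg hdisj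
  set e : ι → ℝ := fun i => F (Pi.single i 1) with he
  have hF : ∀ v : ι → ℝ, F v = ∑ i, v i * e i := by
    intro v
    conv_lhs => rw [pi_eq_sum_univ' v]
    simp [he, map_sum]
  obtain ⟨x₀, hx₀⟩ := hne
  have hbase : ∀ i, ∀ r : ℝ, 0 ≤ r → (V + 1) * ∑ j, e j + r * e i < u := by
    intro i r hr
    have := hFs ((fun _ => V + 1) + r • Pi.single i 1) (fun j => by
      have : (0 : ℝ) ≤ (Pi.single i 1 : ι → ℝ) j := by
        by_cases hj : j = i
        · subst hj; simp
        · simp [Pi.single_eq_of_ne hj]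
      simp only [Pi.add_apply, Pi.smul_apply, smul_eq_mul]
      nlinarith [mul_nonneg hr this])
    rw [map_add, map_smul, hF, ← Finset.mul_sum] at this
    simpa [he] using this
  have hneg : ∀ i, e i ≤ 0 := by
    intro i
    by_contra hcon
    push Not at hcon
    have h0 := hbase i 0 le_rfl
    have h1 := hbase i ((u - (V + 1) * ∑ j, e j) / e i) (div_nonneg (by linarith) hcon.le)
    rw [div_mul_cancel₀ _ hcon.ne'] at h1
    linarith
  have hu : V * ∑ j, e j ≤ u := by
    refine le_of_forall_pos_le_add fun ε hε => ?_
    have hS : 0 < 1 - ∑ j, e j := by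
      have : ∑ j, e j ≤ 0 := Finset.sum_nonpos fun i _ => hneg i
      linarith
    have := hFs (fun _ => V + ε / (1 - ∑ j, e j)) fun i => by
      have := div_pos hε hS
      linarith
    rw [hF, ← Finset.mul_sum] at this
    have h2 : ε / (1 - ∑ j, e j) * (1 - ∑ j, e j) = ε := div_mul_cancel₀ _ hS.ne'
    have h3 := div_pos hε hS
    nlinarith
  have hsum : ∑ j, e j < 0 := by
    refine lt_of_le_of_ne (Finset.sum_nonpos fun i _ => hneg i) fun h0 => ?_
    have hz : ∀ i, e i = 0 := fun i =>
      (Finset.sum_eq_zero_iff_of_nonpos fun i _ => hneg i).1 h0 i (Finset.mem_univ i)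
    have h1 := hFs (fun _ => V + 1) fun _ => by linarith
    have h2 := hFt _ ⟨x₀, hx₀, rfl⟩
    rw [hF] at h1 h2
    simp only [hz, mul_zero, Finset.sum_const_zero] at h1 h2
    linarith
  refine ⟨fun i => e i / ∑ j, e j, fun i => div_nonneg_of_nonpos (hneg i) hsum.le,
    by rw [← Finset.sum_div, div_self hsum.ne], fun x hx => ?_⟩
  have h2 := hFt _ ⟨x, hx, rfl⟩
  rw [hF] at h2
  have h3 : ∑ i, e i / (∑ j, e j) * Z i x = (∑ i, Z i x * e i) / ∑ j, e j := by
    rw [Finset.sum_div]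
    exact Finset.sum_congr rfl fun i _ => by ring
  rw [h3, div_le_iff_of_neg hsum]
  linarith

/-- The affine function interpolating `Φ 0, Φ 1, …` along the chain of vertices of the unit cube
in which coordinate `i` is switched on at step `e i`. -/
def chainInterp (T : ℕ) (e : Equiv.Perm ℕ) (Φ : ℕ → ℝ) (ω : ℕ → ℝ) : ℝ :=
  Φ 0 + ∑ i ∈ Finset.range T, (Φ (e i + 1) - Φ (e i)) * ω i

/-- The vertices of the chain of `chainInterp`. -/
def chainVertex (e : Equiv.Perm ℕ) (m : ℕ) : ℕ → ℝ := fun i => if e i < m then 1 else 0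

lemma chainVertex_mem (e : Equiv.Perm ℕ) (m i : ℕ) : chainVertex e m i ∈ Set.Icc (0 : ℝ) 1 := by
  unfold chainVertex; split_ifs <;> simp

lemma chainVertex_mono (e : Equiv.Perm ℕ) : Monotone (chainVertex e) := by
  intro m n hmn i
  unfold chainVertex
  split_ifs with h1 h2
  · exact le_rfl
  · omega
  · simp
  · exact le_rfl

lemma chainVertex_succ_of_ne (e : Equiv.Perm ℕ) {i j : ℕ} (hij : j ≠ i) :
    chainVertex e (e i + 1) j = chainVertex e (e i) j := by
  have hne : e j ≠ e i := fun h => hij (e.injective h)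
  unfold chainVertex
  congr 1
  simp only [eq_iff_iff]
  omega

lemma chainInterp_add (T : ℕ) (e : Equiv.Perm ℕ) (Φ Ψ ω : ℕ → ℝ) :
    chainInterp T e (fun m => Φ m + Ψ m) ω = chainInterp T e Φ ω + chainInterp T e Ψ ω := by
  have : ∑ i ∈ Finset.range T, (Φ (e i + 1) + Ψ (e i + 1) - (Φ (e i) + Ψ (e i))) * ω i
      = ∑ i ∈ Finset.range T, (Φ (e i + 1) - Φ (e i)) * ω i
        + ∑ i ∈ Finset.range T, (Ψ (e i + 1) - Ψ (e i)) * ω i := by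
    rw [← Finset.sum_add_distrib]
    exact Finset.sum_congr rfl fun i _ => by ring
  simp only [chainInterp, this]
  ring

lemma chainInterp_const_mul (T : ℕ) (e : Equiv.Perm ℕ) (c : ℝ) (Φ ω : ℕ → ℝ) :
    chainInterp T e (fun m => c * Φ m) ω = c * chainInterp T e Φ ω := by
  simp only [chainInterp, mul_add, Finset.mul_sum]
  congr 1
  exact Finset.sum_congr rfl fun i _ => by ring

lemma chainInterp_const (T : ℕ) (e : Equiv.Perm ℕ) (c : ℝ) (ω : ℕ → ℝ) :
    chainInterp T e (fun _ => c) ω = c := by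
  simp [chainInterp]

lemma chainInterp_sum (T : ℕ) (e : Equiv.Perm ℕ) (s : Finset ℕ) (Φ : ℕ → ℕ → ℝ) (ω : ℕ → ℝ) :
    chainInterp T e (fun m => ∑ n ∈ s, Φ n m) ω = ∑ n ∈ s, chainInterp T e (Φ n) ω := by
  classical
  induction s using Finset.induction_on with
  | empty => simp [chainInterp]
  | insert a s ha ih => simp only [Finset.sum_insert ha, chainInterp_add, ih]

lemma chainInterp_chainVertex {T : ℕ} (e : Equiv.Perm ℕ) {n : ℕ} (hn : n < T) (ω : ℕ → ℝ) :
    chainInterp T e (fun m => chainVertex e m n) ω = ω n := by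
  unfold chainInterp
  rw [Finset.sum_eq_single_of_mem n (Finset.mem_range.2 hn)]
  · simp [chainVertex]
  · intro i _ hi
    simp [chainVertex_succ_of_ne e hi.symm]

lemma chainInterp_combo (T : ℕ) (e : Equiv.Perm ℕ) (Φ x y : ℕ → ℝ) (a b : ℝ) (hab : a + b = 1) :
    chainInterp T e Φ (a • x + b • y) = a * chainInterp T e Φ x + b * chainInterp T e Φ y := by
  simp only [chainInterp, mul_add, Finset.mul_sum, Pi.add_apply, Pi.smul_apply, smul_eq_mul,
    Finset.sum_add_distrib]
  have h1 : ∀ z : ℕ → ℝ, ∀ d : ℝ,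
      ∑ i ∈ Finset.range T, (Φ (e i + 1) - Φ (e i)) * (d * z i)
        = ∑ i ∈ Finset.range T, d * ((Φ (e i + 1) - Φ (e i)) * z i) := fun z d =>
    Finset.sum_congr rfl fun i _ => by ring
  rw [h1, h1]
  linear_combination (-Φ 0) * hab

/-- Interpolation written in chain order. -/
lemma chainInterp_eq_sum_symm {T : ℕ} {e : Equiv.Perm ℕ} (he : ∀ i, e i < T ↔ i < T)
    (Φ ω : ℕ → ℝ) :
    chainInterp T e Φ ω
      = Φ 0 + ∑ j ∈ Finset.range T, (Φ (j + 1) - Φ j) * ω (e.symm j) := by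
  unfold chainInterp
  congr 1
  exact Finset.sum_equiv e (by simp [he]) (by simp)

lemma chainInterp_mem_Icc {T : ℕ} {e : Equiv.Perm ℕ} (he : ∀ i, e i < T ↔ i < T)
    {Φ ω : ℕ → ℝ} (hΦ : Monotone Φ) (hω : ∀ i < T, ω i ∈ Set.Icc (0 : ℝ) 1) :
    chainInterp T e Φ ω ∈ Set.Icc (Φ 0) (Φ T) := by
  have hω' : ∀ j ∈ Finset.range T, ω (e.symm j) ∈ Set.Icc (0 : ℝ) 1 := fun j hj =>
    hω _ (by rw [← he]; simpa using hj)
  rw [chainInterp_eq_sum_symm he]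
  constructor
  · have : 0 ≤ ∑ j ∈ Finset.range T, (Φ (j + 1) - Φ j) * ω (e.symm j) :=
      Finset.sum_nonneg fun j hj =>
        mul_nonneg (sub_nonneg.2 (hΦ j.le_succ)) (hω' j hj).1
    linarith
  · have : ∑ j ∈ Finset.range T, (Φ (j + 1) - Φ j) * ω (e.symm j)
        ≤ ∑ j ∈ Finset.range T, (Φ (j + 1) - Φ j) :=
      Finset.sum_le_sum fun j hj =>
        mul_le_of_le_one_right (sub_nonneg.2 (hΦ j.le_succ)) (hω' j hj).2
    rw [Finset.sum_range_sub] at this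
    linarith

/-- A convex function of a nondecreasing chain interpolation is bounded by the interpolation of
its values. -/
lemma ConvexOn.chainInterp_le {f : ℝ → ℝ} (hf : ConvexOn ℝ Set.univ f) {T : ℕ}
    {e : Equiv.Perm ℕ} (he : ∀ i, e i < T ↔ i < T) {X ω : ℕ → ℝ} (hX : Monotone X)
    (hω : ∀ i < T, ω i ∈ Set.Icc (0 : ℝ) 1) :
    f (chainInterp T e X ω) ≤ chainInterp T e (fun m => f (X m)) ω := by
  have hω' : ∀ j < T, ω (e.symm j) ∈ Set.Icc (0 : ℝ) 1 := fun j hj =>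
    hω _ (by rw [← he]; simpa using hj)
  rw [chainInterp_eq_sum_symm he, chainInterp_eq_sum_symm he]
  suffices H : ∀ n ≤ T, X 0 + ∑ j ∈ Finset.range n, (X (j + 1) - X j) * ω (e.symm j) ≤ X n ∧
      f (X 0 + ∑ j ∈ Finset.range n, (X (j + 1) - X j) * ω (e.symm j))
        ≤ f (X 0) + ∑ j ∈ Finset.range n, (f (X (j + 1)) - f (X j)) * ω (e.symm j) from
    (H T le_rfl).2
  intro n
  induction n with
  | zero => simp
  | succ n ih =>
    intro hn
    obtain ⟨h1, h2⟩ := ih (by omega)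
    obtain ⟨hp0, hp1⟩ := hω' n (by omega)
    rw [Finset.sum_range_succ, Finset.sum_range_succ, ← add_assoc, ← add_assoc]
    set S := X 0 + ∑ j ∈ Finset.range n, (X (j + 1) - X j) * ω (e.symm j)
    set p := ω (e.symm n)
    have hd : 0 ≤ X (n + 1) - X n := sub_nonneg.2 (hX n.le_succ)
    refine ⟨by nlinarith, ?_⟩
    have h3 := hf.2 (Set.mem_univ S) (Set.mem_univ (S + (X (n + 1) - X n)))
      (sub_nonneg.2 hp1) hp0 (by ring)
    have h4 := hf.add_sub_le_add_sub h1 hd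
    rw [add_sub_cancel] at h4
    simp only [smul_eq_mul] at h3
    have e1 : (1 - p) * S + p * (S + (X (n + 1) - X n)) = S + (X (n + 1) - X n) * p := by ring
    rw [e1] at h3
    nlinarith

/-- On the simplex spanned by the chain, the interpolation is bounded by any bound for the
values. -/
lemma chainInterp_le_of_antitone {T : ℕ} {e : Equiv.Perm ℕ} (he : ∀ i, e i < T ↔ i < T)
    {Φ ω : ℕ → ℝ} {V : ℝ} (hΦ : ∀ m, Φ m ≤ V) (hω : ∀ i < T, ω i ∈ Set.Icc (0 : ℝ) 1)
    (hanti : ∀ i j, i ≤ j → j < T → ω (e.symm j) ≤ ω (e.symm i)) :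
    chainInterp T e Φ ω ≤ V := by
  have hω' : ∀ j < T, ω (e.symm j) ∈ Set.Icc (0 : ℝ) 1 := fun j hj =>
    hω _ (by rw [← he]; simpa using hj)
  rw [chainInterp_eq_sum_symm he]
  have H : ∀ n ≤ T, ∀ s, s ≤ 1 → (∀ j < n, s ≤ ω (e.symm j)) →
      Φ 0 + ∑ j ∈ Finset.range n, (Φ (j + 1) - Φ j) * ω (e.symm j) ≤ V - (V - Φ n) * s := by
    intro n
    induction n with
    | zero =>
      intro _ s hs _
      simp only [Finset.range_zero, Finset.sum_empty, add_zero]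
      nlinarith [hΦ 0]
    | succ n ih =>
      intro hn s _ hs
      have h1 := ih (by omega) (ω (e.symm n)) (hω' n (by omega)).2
        fun j hj => hanti j n hj.le (by omega)
      rw [Finset.sum_range_succ]
      nlinarith [hs n n.lt_succ_self, hΦ (n + 1)]
  simpa using H T le_rfl 0 zero_le_one fun j hj => (hω' j hj).1

/-- Every point of the cube lies in the simplex of some chain. -/
lemma exists_perm_antitone (T : ℕ) (ω : ℕ → ℝ) :
    ∃ σ : Equiv.Perm (Fin T), ∀ i j, i ≤ j → j < T →
      ω ((σ.extendDomain Fin.equivSubtype).symm j)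
        ≤ ω ((σ.extendDomain Fin.equivSubtype).symm i) := by
  set τ := Tuple.sort (fun i : Fin T => - ω i) with hτ
  refine ⟨τ⁻¹, fun i j hij hj => ?_⟩
  have hi : i < T := by omega
  have key : ∀ k (hk : k < T), ((τ⁻¹).extendDomain Fin.equivSubtype).symm k = τ ⟨k, hk⟩ := by
    intro k hk
    rw [Equiv.symm_apply_eq]
    have := Equiv.Perm.extendDomain_apply_image (τ⁻¹) (Fin.equivSubtype (n := T)) (τ ⟨k, hk⟩)
    simpa using this.symm
  have := Tuple.monotone_sort (fun i : Fin T => - ω i) (a := ⟨i, hi⟩) (b := ⟨j, hj⟩) hij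
  rw [key i hi, key j hj]
  simpa using this

lemma extendDomain_lt_iff {T : ℕ} (σ : Equiv.Perm (Fin T)) (i : ℕ) :
    σ.extendDomain Fin.equivSubtype i < T ↔ i < T := by
  by_cases hi : i < T
  · rw [Equiv.Perm.extendDomain_apply_subtype _ Fin.equivSubtype hi]
    simp [hi]
  · rw [Equiv.Perm.extendDomain_apply_not_subtype _ Fin.equivSubtype hi]

/-- The state trajectory when the next pre-disturbance state at time `n` is `Y n` of the current
one and the disturbance is `lo n + D n * ω n`. -/
def closedLoop (Y : ℕ → ℝ → ℝ) (lo D : ℕ → ℝ) (x₀ : ℝ) (ω : ℕ → ℝ) : ℕ → ℝ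
  | 0 => x₀
  | n + 1 => Y n (closedLoop Y lo D x₀ ω n) + (lo n + D n * ω n)

lemma closedLoop_congr (Y : ℕ → ℝ → ℝ) (lo D : ℕ → ℝ) (x₀ : ℝ) {ω ω' : ℕ → ℝ} {n : ℕ}
    (h : ∀ i < n, ω i = ω' i) : closedLoop Y lo D x₀ ω n = closedLoop Y lo D x₀ ω' n := by
  induction n with
  | zero => rfl
  | succ n ih =>
    simp only [closedLoop]
    rw [ih fun i hi => h i (by omega), h n (by omega)]

lemma closedLoop_mono {Y : ℕ → ℝ → ℝ} {lo D : ℕ → ℝ} (x₀ : ℝ) {n : ℕ}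
    (hY : ∀ k < n, Monotone (Y k)) (hD : ∀ k < n, 0 ≤ D k) :
    Monotone fun ω => closedLoop Y lo D x₀ ω n := by
  induction n with
  | zero => exact fun _ _ _ => le_rfl
  | succ n ih =>
    intro ω ω' h
    have h1 := hY n (by omega) (ih (fun k hk => hY k (by omega)) (fun k hk => hD k (by omega)) h)
    have h2 := mul_le_mul_of_nonneg_left (h n) (hD n (by omega))
    simp only [closedLoop]
    linarith

/-- Controls that track monotone, nonexpansive state maps `Y n` can be replaced by affine policies
without increasing the worst-case cost over the unit cube. -/
lemma exists_affine_policy_le {T : ℕ} {x₀ V : ℝ} {h : ℕ → ℝ → ℝ} {c L U lo D : ℕ → ℝ}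
    {Y : ℕ → ℝ → ℝ} (hconv : ∀ n < T, ConvexOn ℝ Set.univ (h n)) (hD : ∀ n < T, 0 ≤ D n)
    (hY : ∀ n < T, Monotone (Y n)) (hY' : ∀ n < T, Monotone fun x => x - Y n x)
    (hYmem : ∀ n < T, ∀ x, Y n x - x ∈ Set.Icc (L n) (U n))
    (hV : ∀ ω : ℕ → ℝ, (∀ i, ω i ∈ Set.Icc (0 : ℝ) 1) →
      ∑ n ∈ Finset.range T,
        (c n * (Y n (closedLoop Y lo D x₀ ω n) - closedLoop Y lo D x₀ ω n)
          + h n (closedLoop Y lo D x₀ ω (n + 1))) ≤ V) :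
    ∃ (a : ℕ → ℝ) (b : ℕ → ℕ → ℝ), ∀ ω : ℕ → ℝ, (∀ i < T, ω i ∈ Set.Icc (0 : ℝ) 1) →
      (∀ n < T, a n + ∑ i ∈ Finset.range n, b n i * ω i ∈ Set.Icc (L n) (U n)) ∧
      ∑ n ∈ Finset.range T,
        (c n * (a n + ∑ i ∈ Finset.range n, b n i * ω i)
          + h n (x₀ + ∑ k ∈ Finset.range (n + 1),
              ((a k + ∑ i ∈ Finset.range k, b k i * ω i) + (lo k + D k * ω k)))) ≤ V := by
  classical
  set e : Equiv.Perm (Fin T) → Equiv.Perm ℕ := fun σ => σ.extendDomain Fin.equivSubtype with he_def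
  have he : ∀ σ i, e σ i < T ↔ i < T := fun σ => extendDomain_lt_iff σ
  -- state, control and cost along the vertices of a chain
  set X : Equiv.Perm (Fin T) → ℕ → ℕ → ℝ :=
    fun σ n m => closedLoop Y lo D x₀ (chainVertex (e σ) m) n with hX_def
  set u : Equiv.Perm (Fin T) → ℕ → ℕ → ℝ := fun σ n m => Y n (X σ n m) - X σ n m with hu_def
  set C : Equiv.Perm (Fin T) → ℕ → ℝ :=
    fun σ m => ∑ n ∈ Finset.range T, (c n * u σ n m + h n (X σ (n + 1) m)) with hC_def
  have hXmono : ∀ σ, ∀ n ≤ T, Monotone (X σ n) := fun σ n hn =>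
    (closedLoop_mono x₀ (fun k hk => hY k (by omega)) (fun k hk => hD k (by omega))).comp
      (chainVertex_mono (e σ))
  have humono : ∀ σ, ∀ n < T, Monotone fun m => - u σ n m := by
    intro σ n hn m m' hm
    have := hY' n hn (hXmono σ n hn.le hm)
    simp only [hu_def] at this ⊢
    linarith
  have hCV : ∀ σ m, C σ m ≤ V := fun σ m => hV _ (chainVertex_mem (e σ) m)
  obtain ⟨l, hl0, hl1, hlV⟩ := exists_convex_combination_le
    (K := {ω : ℕ → ℝ | ∀ i < T, ω i ∈ Set.Icc (0 : ℝ) 1})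
    (fun x hx y hy s t hs ht hst i hi => (convex_Icc (0 : ℝ) 1) (hx i hi) (hy i hi) hs ht hst)
    ⟨fun _ => 0, fun i _ => by simp⟩ (fun σ ω => chainInterp T (e σ) (C σ) ω) V
    (fun σ x y s t hst => chainInterp_combo T (e σ) (C σ) x y s t hst)
    (fun ω hω => by
      obtain ⟨σ, hσ⟩ := exists_perm_antitone T ω
      exact ⟨σ, chainInterp_le_of_antitone (he σ) (hCV σ) hω hσ⟩)
  set P : Equiv.Perm (Fin T) → ℕ → (ℕ → ℝ) → ℝ :=
    fun σ n ω => chainInterp T (e σ) (u σ n) ω with hP_def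
  have hPmem : ∀ σ, ∀ n < T, ∀ ω : ℕ → ℝ, (∀ i < T, ω i ∈ Set.Icc (0 : ℝ) 1) →
      P σ n ω ∈ Set.Icc (L n) (U n) := by
    intro σ n hn ω hω
    have h1 := chainInterp_mem_Icc (he σ) (humono σ n hn) hω
    have h2 : chainInterp T (e σ) (fun m => - u σ n m) ω = - P σ n ω := by
      simpa using chainInterp_const_mul T (e σ) (-1) (u σ n) ω
    rw [h2] at h1
    have h3 := (hYmem n hn (X σ n 0)).2
    have h4 := (hYmem n hn (X σ n T)).1
    have h5 := h1.1
    have h6 := h1.2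
    simp only [hu_def] at h5 h6
    exact ⟨by linarith, by linarith⟩
  have hstate : ∀ σ ω, ∀ n ≤ T, x₀ + ∑ k ∈ Finset.range n, (P σ k ω + (lo k + D k * ω k))
      = chainInterp T (e σ) (X σ n) ω := by
    intro σ ω n
    induction n with
    | zero =>
      intro _
      have : X σ 0 = fun _ => x₀ := rfl
      rw [this, chainInterp_const]
      simp
    | succ n ih =>
      intro hn
      have hsucc : X σ (n + 1)
          = fun m => (X σ n m + u σ n m) + (lo n + D n * chainVertex (e σ) m n) := by
        funext m
        simp only [hu_def, hX_def, closedLoop]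
        ring
      rw [Finset.sum_range_succ, ← add_assoc, ih (by omega), hsucc, chainInterp_add,
        chainInterp_add, chainInterp_add, chainInterp_const, chainInterp_const_mul,
        chainInterp_chainVertex _ (by omega)]
      ring
  have hPsum : ∀ σ n ω, n < T → P σ n ω = u σ n 0
      + ∑ i ∈ Finset.range n, (u σ n (e σ i + 1) - u σ n (e σ i)) * ω i := by
    intro σ n ω hn
    simp only [hP_def, chainInterp]
    congr 1
    symm
    refine Finset.sum_subset (Finset.range_subset_range.2 hn.le) fun i _ hi => ?_
    have hni : n ≤ i := by simpa using hi
    have : X σ n (e σ i + 1) = X σ n (e σ i) :=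
      closedLoop_congr _ _ _ _ fun j hj => chainVertex_succ_of_ne _ (by omega)
    simp [hu_def, this]
  refine ⟨fun n => ∑ σ, l σ * u σ n 0,
    fun n i => ∑ σ, l σ * (u σ n (e σ i + 1) - u σ n (e σ i)), fun ω hω => ?_⟩
  have hpol : ∀ n < T, ∑ σ, l σ * u σ n 0 + ∑ i ∈ Finset.range n,
      (∑ σ, l σ * (u σ n (e σ i + 1) - u σ n (e σ i))) * ω i = ∑ σ, l σ * P σ n ω := by
    intro n hn
    simp only [hPsum _ n ω hn, mul_add, Finset.sum_add_distrib, Finset.mul_sum, Finset.sum_mul]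
    rw [Finset.sum_comm (s := Finset.range n)]
    simp only [mul_assoc]
  constructor
  · intro n hn
    rw [hpol n hn]
    exact (convex_Icc (L n) (U n)).sum_mem (fun σ _ => hl0 σ) hl1 fun σ _ => hPmem σ n hn ω hω
  · refine le_trans ?_ (hlV ω hω)
    have hterm : ∀ n ∈ Finset.range T,
        (c n * (∑ σ, l σ * u σ n 0 + ∑ i ∈ Finset.range n,
            (∑ σ, l σ * (u σ n (e σ i + 1) - u σ n (e σ i))) * ω i)
          + h n (x₀ + ∑ k ∈ Finset.range (n + 1), ((∑ σ, l σ * u σ k 0 + ∑ i ∈ Finset.range k,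
            (∑ σ, l σ * (u σ k (e σ i + 1) - u σ k (e σ i))) * ω i) + (lo k + D k * ω k))))
        ≤ ∑ σ, l σ * chainInterp T (e σ) (fun m => c n * u σ n m + h n (X σ (n + 1) m)) ω := by
      intro n hn
      have hn' : n < T := Finset.mem_range.1 hn
      have hx : x₀ + ∑ k ∈ Finset.range (n + 1), ((∑ σ, l σ * u σ k 0 + ∑ i ∈ Finset.range k,
            (∑ σ, l σ * (u σ k (e σ i + 1) - u σ k (e σ i))) * ω i) + (lo k + D k * ω k))
          = ∑ σ, l σ • chainInterp T (e σ) (X σ (n + 1)) ω := by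
        have h1 : ∀ k ∈ Finset.range (n + 1),
            ((∑ σ, l σ * u σ k 0 + ∑ i ∈ Finset.range k,
              (∑ σ, l σ * (u σ k (e σ i + 1) - u σ k (e σ i))) * ω i) + (lo k + D k * ω k))
            = ∑ σ, l σ * (P σ k ω + (lo k + D k * ω k)) := by
          intro k hk
          rw [hpol k (by have := Finset.mem_range.1 hk; omega)]
          simp only [mul_add, Finset.sum_add_distrib, ← Finset.sum_mul, hl1, one_mul]
        rw [Finset.sum_congr rfl h1, Finset.sum_comm]
        simp only [← hstate _ ω (n + 1) hn', smul_eq_mul, mul_add, Finset.sum_add_distrib,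
          ← Finset.sum_mul, hl1, one_mul, Finset.mul_sum]
      rw [hx, hpol n hn']
      have hjen := (hconv n hn').map_sum_le (t := Finset.univ) (w := l)
        (p := fun σ => chainInterp T (e σ) (X σ (n + 1)) ω)
        (fun σ _ => hl0 σ) hl1 (fun σ _ => Set.mem_univ _)
      have hle : ∑ σ, l σ • h n (chainInterp T (e σ) (X σ (n + 1)) ω)
          ≤ ∑ σ, l σ * chainInterp T (e σ) (fun m => h n (X σ (n + 1) m)) ω :=
        Finset.sum_le_sum fun σ _ => mul_le_mul_of_nonneg_left
          ((hconv n hn').chainInterp_le (he σ) (hXmono σ (n + 1) hn') hω) (hl0 σ)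
      simp only [chainInterp_add, chainInterp_const_mul, mul_add, Finset.sum_add_distrib,
        Finset.mul_sum, mul_left_comm (c n)]
      exact add_le_add le_rfl (hjen.trans hle)
    refine (Finset.sum_le_sum hterm).trans (le_of_eq ?_)
    rw [Finset.sum_comm]
    refine Finset.sum_congr rfl fun σ _ => ?_
    rw [← Finset.mul_sum, ← chainInterp_sum]

/-- Against any nonanticipative feasible policy `p`, the adversary can force the
dynamic-programming value. -/
lemma exists_disturbance_ge {T : ℕ} {x₀ : ℝ} {h J : ℕ → ℝ → ℝ} {c L U lo hi : ℕ → ℝ}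
    (hw : ∀ n < T, lo n ≤ hi n)
    (hJ : ∀ n < T, ∀ x, ∀ u ∈ Set.Icc (L n) (U n), ∃ w ∈ Set.Icc (lo n) (hi n),
      J n x ≤ c n * u + (h n (x + u + w) + J (n + 1) (x + u + w)))
    {p : ℕ → (ℕ → ℝ) → ℝ}
    (hp : ∀ n w w', (∀ i < n, w i = w' i) → p n w = p n w')
    (hfeas : ∀ w : ℕ → ℝ, (∀ i < T, w i ∈ Set.Icc (lo i) (hi i)) →
      ∀ n < T, p n w ∈ Set.Icc (L n) (U n)) {n : ℕ} (hn : n ≤ T) :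
    ∃ w : ℕ → ℝ, (∀ i < T, w i ∈ Set.Icc (lo i) (hi i)) ∧
      J 0 x₀ ≤ ∑ k ∈ Finset.range n,
          (c k * p k w + h k (x₀ + ∑ j ∈ Finset.range (k + 1), (p j w + w j)))
        + J n (x₀ + ∑ j ∈ Finset.range n, (p j w + w j)) := by
  induction n with
  | zero => exact ⟨lo, fun i hi => ⟨le_rfl, hw i hi⟩, by simp⟩
  | succ n ih =>
    obtain ⟨w, hwmem, hle⟩ := ih (by omega)
    obtain ⟨v, hv, hvle⟩ := hJ n (by omega) (x₀ + ∑ j ∈ Finset.range n, (p j w + w j)) (p n w)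
      (hfeas w hwmem n (by omega))
    have hlt : ∀ i < n, Function.update w n v i = w i := fun i hi =>
      Function.update_of_ne (by omega) _ _
    have hpe : ∀ k ≤ n, p k (Function.update w n v) = p k w := fun k hk =>
      hp k _ _ fun i hi => hlt i (by omega)
    have hxe : ∀ k ≤ n, ∑ j ∈ Finset.range k,
        (p j (Function.update w n v) + Function.update w n v j)
        = ∑ j ∈ Finset.range k, (p j w + w j) := fun k hk =>
      Finset.sum_congr rfl fun j hj => by
        have := Finset.mem_range.1 hj
        rw [hpe j (by omega), hlt j (by omega)]
    refine ⟨Function.update w n v, fun i hi => ?_, ?_⟩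
    · by_cases hin : i = n
      · subst hin
        simpa using hv
      · rw [Function.update_of_ne hin]
        exact hwmem i hi
    · rw [Finset.sum_range_succ]
      have hcost : ∑ k ∈ Finset.range n, (c k * p k (Function.update w n v)
            + h k (x₀ + ∑ j ∈ Finset.range (k + 1),
              (p j (Function.update w n v) + Function.update w n v j)))
          = ∑ k ∈ Finset.range n,
            (c k * p k w + h k (x₀ + ∑ j ∈ Finset.range (k + 1), (p j w + w j))) :=
        Finset.sum_congr rfl fun k hk => by
          have := Finset.mem_range.1 hk
          rw [hpe k (by omega), hxe (k + 1) (by omega)]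
      have hlast : x₀ + ∑ j ∈ Finset.range (n + 1),
            (p j (Function.update w n v) + Function.update w n v j)
          = x₀ + ∑ j ∈ Finset.range n, (p j w + w j) + p n w + v := by
        rw [Finset.sum_range_succ, hxe n le_rfl, hpe n le_rfl, Function.update_self]
        ring
      rw [hcost, hlast, hpe n le_rfl]
      linarith

/-- Optimality of affine policies, with stages numbered from `0`. -/
lemma exists_affine_policy_optimal {T : ℕ} {x₀ : ℝ} {h J : ℕ → ℝ → ℝ} {c L U lo hi : ℕ → ℝ}
    (hconv : ∀ n < T, ConvexOn ℝ Set.univ (h n)) (hLU : ∀ n < T, L n ≤ U n)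
    (hw : ∀ n < T, lo n ≤ hi n) (hJend : ∀ x, J T x = 0)
    (hJrec : ∀ n < T, ∀ x, J n x = sInf { y | ∃ u ∈ Set.Icc (L n) (U n),
        y = c n * u + sSup { z | ∃ w ∈ Set.Icc (lo n) (hi n),
          z = h n (x + u + w) + J (n + 1) (x + u + w) } }) :
    ∃ (a : ℕ → ℝ) (b : ℕ → ℕ → ℝ),
      (∀ n < T, ∀ w : ℕ → ℝ, (∀ i < n, w i ∈ Set.Icc (lo i) (hi i)) →
        a n + ∑ i ∈ Finset.range n, b n i * w i ∈ Set.Icc (L n) (U n)) ∧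
      IsGreatest { v | ∃ w : ℕ → ℝ, (∀ i < T, w i ∈ Set.Icc (lo i) (hi i)) ∧
        v = ∑ n ∈ Finset.range T,
          (c n * (a n + ∑ i ∈ Finset.range n, b n i * w i)
            + h n (x₀ + ∑ k ∈ Finset.range (n + 1),
                ((a k + ∑ i ∈ Finset.range k, b k i * w i) + w k))) } (J 0 x₀) := by
  have hJconv : ∀ n ≤ T, ConvexOn ℝ Set.univ (J n) := by
    intro n hn
    induction hn using Nat.decreasingInduction with
    | self =>
      have : J T = fun _ => 0 := funext hJend
      rw [this]
      exact convexOn_const 0 convex_univ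
    | of_succ n hn ih =>
      obtain ⟨_, _, _, _, hc, _⟩ := exists_robust_step ((hconv n hn).add ih) (hLU n hn) (hw n hn)
        (hJrec n hn)
      exact hc
  have hstep : ∀ n, ∃ Y : ℝ → ℝ, n < T → Monotone Y ∧ Monotone (fun x => x - Y x) ∧
      (∀ x, Y x - x ∈ Set.Icc (L n) (U n)) ∧
      (∀ x, ∀ w ∈ Set.Icc (lo n) (hi n),
        c n * (Y x - x) + (h n (Y x + w) + J (n + 1) (Y x + w)) ≤ J n x) ∧
      (∀ x, ∀ u ∈ Set.Icc (L n) (U n), ∃ w ∈ Set.Icc (lo n) (hi n),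
        J n x ≤ c n * u + (h n (x + u + w) + J (n + 1) (x + u + w))) := by
    intro n
    by_cases hn : n < T
    · obtain ⟨Y, h1, h2, h3, _, h5, h6⟩ := exists_robust_step
        ((hconv n hn).add (hJconv (n + 1) hn)) (hLU n hn) (hw n hn) (hJrec n hn)
      exact ⟨Y, fun _ => ⟨h1, h2, h3, h5, h6⟩⟩
    · exact ⟨id, fun h => absurd h hn⟩
  choose Y hY using hstep
  set D : ℕ → ℝ := fun n => hi n - lo n with hD_def
  have hD : ∀ n < T, 0 ≤ D n := fun n hn => sub_nonneg.2 (hw n hn)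
  have hV : ∀ ω : ℕ → ℝ, (∀ i, ω i ∈ Set.Icc (0 : ℝ) 1) →
      ∑ n ∈ Finset.range T,
        (c n * (Y n (closedLoop Y lo D x₀ ω n) - closedLoop Y lo D x₀ ω n)
          + h n (closedLoop Y lo D x₀ ω (n + 1))) ≤ J 0 x₀ := by
    intro ω hω
    have H : ∀ m ≤ T, ∑ n ∈ Finset.range m,
        (c n * (Y n (closedLoop Y lo D x₀ ω n) - closedLoop Y lo D x₀ ω n)
          + h n (closedLoop Y lo D x₀ ω (n + 1))) + J m (closedLoop Y lo D x₀ ω m)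
        ≤ J 0 x₀ := by
      intro m
      induction m with
      | zero => simp [closedLoop]
      | succ m ih =>
        intro hm
        have h1 := ih (by omega)
        have h2 := (hY m hm).2.2.2.1 (closedLoop Y lo D x₀ ω m) (lo m + D m * ω m)
          ⟨by nlinarith [hD m hm, (hω m).1],
            by nlinarith [hD m hm, (hω m).2, show D m = hi m - lo m from rfl]⟩
        rw [Finset.sum_range_succ]
        simp only [closedLoop] at h1 ⊢
        linarith
    simpa [hJend] using H T le_rfl
  obtain ⟨a, b, hab⟩ := exists_affine_policy_le hconv hD (fun n hn => (hY n hn).1)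
    (fun n hn => (hY n hn).2.1) (fun n hn => (hY n hn).2.2.1) hV
  set p : ℕ → (ℕ → ℝ) → ℝ := fun n w =>
    (a n - ∑ i ∈ Finset.range n, b n i / D i * lo i) + ∑ i ∈ Finset.range n, b n i / D i * w i
    with hp_def
  have hpω : ∀ n w, p n w
      = a n + ∑ i ∈ Finset.range n, b n i * ((w i - lo i) / D i) := by
    intro n w
    have : ∑ i ∈ Finset.range n, b n i * ((w i - lo i) / D i)
        = ∑ i ∈ Finset.range n, b n i / D i * w i - ∑ i ∈ Finset.range n, b n i / D i * lo i := by
      rw [← Finset.sum_sub_distrib]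
      exact Finset.sum_congr rfl fun i _ => by ring
    rw [this]
    simp only [hp_def]
    ring
  have hpcongr : ∀ n w w', (∀ i < n, w i = w' i) → p n w = p n w' := by
    intro n w w' hww
    simp only [hp_def]
    congr 1
    exact Finset.sum_congr rfl fun i hi => by rw [hww i (Finset.mem_range.1 hi)]
  have hcube : ∀ w : ℕ → ℝ, (∀ i < T, w i ∈ Set.Icc (lo i) (hi i)) →
      ∀ i < T, (w i - lo i) / D i ∈ Set.Icc (0 : ℝ) 1 := fun w hwm i hi' =>
    ⟨div_nonneg (sub_nonneg.2 (hwm i hi').1) (hD i hi'),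
      div_le_one_of_le₀ (sub_le_sub_right (hwm i hi').2 _) (hD i hi')⟩
  have hfeas : ∀ w : ℕ → ℝ, (∀ i < T, w i ∈ Set.Icc (lo i) (hi i)) →
      ∀ n < T, p n w ∈ Set.Icc (L n) (U n) := by
    intro w hwm n hn
    rw [hpω]
    exact (hab _ (hcube w hwm)).1 n hn
  have hcost : ∀ w : ℕ → ℝ, (∀ i < T, w i ∈ Set.Icc (lo i) (hi i)) →
      ∑ n ∈ Finset.range T, (c n * p n w
        + h n (x₀ + ∑ k ∈ Finset.range (n + 1), (p k w + w k))) ≤ J 0 x₀ := by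
    intro w hwm
    refine le_trans (le_of_eq ?_) (hab _ (hcube w hwm)).2
    refine Finset.sum_congr rfl fun n hn => ?_
    have hn' := Finset.mem_range.1 hn
    rw [hpω]
    congr 3
    refine Finset.sum_congr rfl fun k hk => ?_
    have hk' : k < T := by have := Finset.mem_range.1 hk; omega
    rw [hpω]
    congr 1
    by_cases h0 : D k = 0
    · have h1 := hwm k hk'
      simp only [hD_def] at h0
      have : w k = lo k := by linarith [h1.1, h1.2]
      simp [this]
    · rw [mul_div_cancel₀ _ h0]
      ring
  refine ⟨fun n => a n - ∑ i ∈ Finset.range n, b n i / D i * lo i, fun n i => b n i / D i,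
    ?_, ?_, ?_⟩
  · intro n hn w hwm
    have h1 := hfeas (fun i => if i < n then w i else lo i) (fun i hi' => by
      split_ifs with hin
      · exact hwm i hin
      · exact ⟨le_rfl, hw i hi'⟩) n hn
    rwa [hpcongr n _ w fun i hi' => by simp [hi']] at h1
  · obtain ⟨w, hwm, hle⟩ := exists_disturbance_ge (x₀ := x₀) hw
      (fun n hn => (hY n hn).2.2.2.2) hpcongr hfeas le_rfl
    rw [hJend, add_zero] at hle
    exact ⟨w, hwm, le_antisymm hle (hcost w hwm)⟩
  · rintro v ⟨w, hwm, rfl⟩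
    exact hcost w hwm

lemma sum_Icc_one_eq_sum_range (f : ℕ → ℝ) (n : ℕ) :
    ∑ t ∈ Finset.Icc 1 n, f t = ∑ i ∈ Finset.range n, f (i + 1) := by
  induction n with
  | zero => simp
  | succ n ih => rw [Finset.sum_Icc_succ_top (by omega), ih, Finset.sum_range_succ]

/-- Disturbance-affine control policies are optimal for the
one-dimensional multi-stage robust (min-max) control problem: there exist
robustly feasible affine policies whose worst-case total cost equals the
dynamic-programming value `J 1 x1`. -/
theorem affine_policies_optimal
    (T : ℕ) (hT : 1 ≤ T) (x1 : ℝ)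
    (h : ℕ → ℝ → ℝ) (c L U wlo whi : ℕ → ℝ)
    (hconv : ∀ k, 1 ≤ k → k ≤ T → ConvexOn ℝ Set.univ (h k))
    (hcoer : ∀ k, 1 ≤ k → k ≤ T →
      Filter.Tendsto (h k) (Filter.cocompact ℝ) Filter.atTop)
    (hc : ∀ k, 1 ≤ k → k ≤ T → 0 ≤ c k)
    (hLU : ∀ k, 1 ≤ k → k ≤ T → L k ≤ U k)
    (hw : ∀ k, 1 ≤ k → k ≤ T → wlo k ≤ whi k)
    (J : ℕ → ℝ → ℝ)
    (hJend : ∀ x : ℝ, J (T + 1) x = 0)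
    (hJrec : ∀ k, 1 ≤ k → k ≤ T → ∀ x : ℝ,
      J k x = sInf { y | ∃ u ∈ Set.Icc (L k) (U k),
        y = c k * u + sSup { z | ∃ w ∈ Set.Icc (wlo k) (whi k),
          z = h k (x + u + w) + J (k + 1) (x + u + w) } }) :
    ∃ q : ℕ → ℕ → ℝ,
      -- robust feasibility of the affine policies
      (∀ k, 1 ≤ k → k ≤ T →
        ∀ w : ℕ → ℝ, (∀ t, 1 ≤ t → t ≤ k - 1 → w t ∈ Set.Icc (wlo t) (whi t)) →
          q k 0 + ∑ t ∈ Finset.Icc 1 (k - 1), q k t * w t ∈ Set.Icc (L k) (U k)) ∧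
      -- the worst-case cost of the affine policies equals the min-max value
      IsGreatest
        { v | ∃ w : ℕ → ℝ,
            (∀ t, 1 ≤ t → t ≤ T → w t ∈ Set.Icc (wlo t) (whi t)) ∧
            v = ∑ t ∈ Finset.Icc 1 T,
                  (c t * (q t 0 + ∑ τ ∈ Finset.Icc 1 (t - 1), q t τ * w τ)
                    + h t (x1 + ∑ τ ∈ Finset.Icc 1 t,
                        ((q τ 0 + ∑ σ ∈ Finset.Icc 1 (τ - 1), q τ σ * w σ) + w τ))) }
        (J 1 x1) := by
  obtain ⟨a, b, hfeas, hgreat⟩ := exists_affine_policy_optimal (T := T) (x₀ := x1)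
    (h := fun n => h (n + 1)) (J := fun n => J (n + 1)) (c := fun n => c (n + 1))
    (L := fun n => L (n + 1)) (U := fun n => U (n + 1)) (lo := fun n => wlo (n + 1))
    (hi := fun n => whi (n + 1)) (fun n hn => hconv _ (by omega) hn)
    (fun n hn => hLU _ (by omega) hn) (fun n hn => hw _ (by omega) hn) hJend
    (fun n hn => hJrec _ (by omega) hn)
  refine ⟨fun k t => if t = 0 then a (k - 1) else b (k - 1) (t - 1), ?_, ?_⟩
  · intro k hk hkT w hwm
    obtain ⟨n, rfl⟩ : ∃ n, k = n + 1 := ⟨k - 1, by omega⟩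
    have := hfeas n (by omega) (fun i => w (i + 1)) fun i hi => hwm _ (by omega) (by omega)
    simpa [sum_Icc_one_eq_sum_range] using this
  · convert hgreat using 1
    ext v
    constructor
    · rintro ⟨w, hwm, rfl⟩
      exact ⟨fun i => w (i + 1), fun i hi => hwm _ (by omega) (by omega),
        by simp [sum_Icc_one_eq_sum_range]⟩
    · rintro ⟨w, hwm, rfl⟩
      refine ⟨fun t => w (t - 1), fun t ht htT => ?_, by simp [sum_Icc_one_eq_sum_range]⟩
      have := hwm (t - 1) (by omega)
      rwa [Nat.sub_add_cancel ht] at this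
end
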